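/- arXiv:2512.02858 — 9 statements merged into one kernel-verified Lean document; each statement's English description precedes it below -/
import Mathlib

section
/- Let h : Θ × W^S → ℝ be jointly measurable and suppose E_{S ∼ D^{⊗S}} E_{θ ∼ P} exp(h(θ, S)) ≤ 1, where P is a probability measure on Θ and D^{⊗S} is the S-fold product of a probability measure D on W. Let Q be a Markov kernel from W^S to Θ such that Q(S) is absolutely continuous with respect to P for D^{⊗S}-almost every S. Then for every δ ∈ (0,1), with probability at least 1 − δ under the joint law obtained by sampling S ∼ D^{⊗S} and then θ ∼ Q(S), it holds that h(θ, S) ≤ ln((dQ(S)/dP)(θ)) + ln(1/δ). -/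
open MeasureTheory ProbabilityTheory

/-- Change-of-measure lemma underlying randomized PAC-Bayes bounds. -/
theorem pac_bayes_change_of_measure
    {Θ W : Type*} [MeasurableSpace Θ] [MeasurableSpace W]
    (D : Measure W) [IsProbabilityMeasure D]
    (S : ℕ) (hS : 1 ≤ S)
    (P : Measure Θ) [IsProbabilityMeasure P]
    (h : Θ × (Fin S → W) → ℝ) (hmeas : Measurable h)
    (hexp : ∫⁻ s, ∫⁻ θ, ENNReal.ofReal (Real.exp (h (θ, s))) ∂P
              ∂(Measure.pi fun _ : Fin S => D) ≤ 1)
    (Q : Kernel (Fin S → W) Θ) [IsMarkovKernel Q]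
    (hac : ∀ᵐ s ∂(Measure.pi fun _ : Fin S => D), Q s ≪ P)
    (δ : ℝ) (hδ : δ ∈ Set.Ioo (0 : ℝ) 1) :
    ENNReal.ofReal (1 - δ) ≤
      ((Measure.pi fun _ : Fin S => D) ⊗ₘ Q)
        {p : (Fin S → W) × Θ |
          h (p.2, p.1) ≤ Real.log ((Q p.1).rnDeriv P p.2).toReal + Real.log (1 / δ)} := by
  obtain ⟨hδ0, hδ1⟩ := hδ
  set μ : Measure (Fin S → W) := Measure.pi fun _ : Fin S => D with hμ
  set A : Set ((Fin S → W) × Θ) := {p : (Fin S → W) × Θ |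
          h (p.2, p.1) ≤ Real.log ((Q p.1).rnDeriv P p.2).toReal + Real.log (1 / δ)} with hA
  set B := toMeasurable (μ ⊗ₘ Q) A with hB
  have hBm : MeasurableSet B := measurableSet_toMeasurable _ _
  have hAB : A ⊆ B := subset_toMeasurable _ _
  have hBA : (μ ⊗ₘ Q) B = (μ ⊗ₘ Q) A := measure_toMeasurable _
  have key : (μ ⊗ₘ Q) Bᶜ ≤ ENNReal.ofReal δ := by
    rw [Measure.compProd_apply hBm.compl]
    calc ∫⁻ s, Q s (Prod.mk s ⁻¹' Bᶜ) ∂μ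
        ≤ ∫⁻ s, ENNReal.ofReal δ * ∫⁻ θ, ENNReal.ofReal (Real.exp (h (θ, s))) ∂P ∂μ := by
          apply lintegral_mono_ae
          filter_upwards [hac] with s hs
          have hm : MeasurableSet (Prod.mk s ⁻¹' Bᶜ) := measurable_prodMk_left hBm.compl
          rw [← Measure.setLIntegral_rnDeriv hs, ← lintegral_const_mul' _ _ ENNReal.ofReal_ne_top]
          refine le_trans (setLIntegral_mono_ae' hm ?_) (setLIntegral_le_lintegral _ _)
          filter_upwards [Measure.rnDeriv_lt_top (Q s) P] with θ hfin hθ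
          have hn : ¬ h (θ, s) ≤ Real.log ((Q s).rnDeriv P θ).toReal + Real.log (1 / δ) :=
            fun hc => hθ (hAB hc)
          push Not at hn
          rw [← ENNReal.ofReal_mul hδ0.le, ← ENNReal.ofReal_toReal hfin.ne]
          apply ENNReal.ofReal_le_ofReal
          set r := ((Q s).rnDeriv P θ).toReal with hr
          have hr0 : 0 ≤ r := ENNReal.toReal_nonneg
          rcases hr0.eq_or_lt with h0 | hpos
          · rw [← h0]; positivity
          · have h1 := Real.exp_lt_exp.mpr hn
            rw [Real.exp_add, Real.exp_log hpos, Real.exp_log (by positivity), mul_one_div,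
              div_lt_iff₀ hδ0] at h1
            linarith
      _ = ENNReal.ofReal δ * ∫⁻ s, ∫⁻ θ, ENNReal.ofReal (Real.exp (h (θ, s))) ∂P ∂μ :=
          lintegral_const_mul' _ _ ENNReal.ofReal_ne_top
      _ ≤ ENNReal.ofReal δ * 1 := by gcongr
      _ = ENNReal.ofReal δ := mul_one _
  rw [← hBA, ENNReal.ofReal_sub _ hδ0.le, ENNReal.ofReal_one, tsub_le_iff_right]
  calc (1 : ENNReal) = (μ ⊗ₘ Q) B + (μ ⊗ₘ Q) Bᶜ := by
        rw [measure_add_measure_compl hBm, measure_univ]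
    _ ≤ _ := by gcongr
end

section
/- Let S ∈ ℕ with S ≥ 1, let P be a probability measure on Θ (independent of the data), and let Q be a Markov kernel from W^S to Θ with Q(S) absolutely continuous with respect to P for D^{⊗S}-almost every dataset S. Then for every λ > 0 and δ ∈ (0,1), with probability at least 1 − δ under the joint law obtained by sampling S ∼ D^{⊗S} and then θ ∼ Q(S), the true cost satisfies 𝓛(θ) ≤ L̂(θ, S) + (1/λ) ln((dQ(S)/dP)(θ)) + (1/λ) ln(1/δ) + λ C² / (8 S). -/
open MeasureTheory ProbabilityTheory

lemma pac_hoeffding {W : Type*} [MeasurableSpace W] (D : Measure W) [IsProbabilityMeasure D]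
    (C : ℝ) (f : W → ℝ) (hf : Measurable f) (hfb : ∀ w, f w ∈ Set.Icc 0 C)
    (S : ℕ) (hS : 1 ≤ S) (lam : ℝ) :
    ∫⁻ s, ENNReal.ofReal (Real.exp (lam * ((∫ w, f w ∂D) - (1 / (S : ℝ)) * ∑ i : Fin S, f (s i))
      - lam ^ 2 * C ^ 2 / (8 * S))) ∂(Measure.pi fun _ : Fin S => D) ≤ 1 := by
  have hS0 : (S : ℝ) ≠ 0 := by positivity
  have h1 := (hasSubgaussianMGF_of_mem_Icc (μ := D) hf.aemeasurable
    (Filter.Eventually.of_forall hfb)).neg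
  have h2 : ∀ i ∈ (Finset.univ : Finset (Fin S)), HasSubgaussianMGF
      (fun s : Fin S → W => (∫ w, f w ∂D) - f (s i))
      ((‖C - 0‖₊ / 2) ^ 2) (Measure.pi fun _ : Fin S => D) := by
    intro i _
    have hm := measurePreserving_eval (fun _ : Fin S => D) i
    rw [← hm.map_eq] at h1
    have := h1.of_map hm.measurable.aemeasurable
    refine this.congr (Filter.Eventually.of_forall fun s => ?_)
    have e : ∫ w, f w ∂(Measure.map (Function.eval i) (Measure.pi fun _ : Fin S => D))
      = ∫ w, f w ∂D := by rw [hm.map_eq]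
    simp [e]
  have hind : iIndepFun (fun (i : Fin S) (s : Fin S → W) => (∫ w, f w ∂D) - f (s i))
      (Measure.pi fun _ : Fin S => D) :=
    iIndepFun_pi (X := fun _ w => (∫ w, f w ∂D) - f w)
      (fun i => (measurable_const.sub hf).aemeasurable)
  have h3 := HasSubgaussianMGF.sum_of_iIndepFun hind h2
  have h4 := h3.mgf_le (lam / S)
  have h5 := h3.integrable_exp_mul (lam / S)
  have key : ∀ s : Fin S → W,
      Real.exp (lam * ((∫ w, f w ∂D) - (1 / (S : ℝ)) * ∑ i : Fin S, f (s i))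
      - lam ^ 2 * C ^ 2 / (8 * S)) = Real.exp (- (lam ^ 2 * C ^ 2 / (8 * S))) *
        Real.exp (lam / S * ∑ i : Fin S, ((∫ w, f w ∂D) - f (s i))) := by
    intro s
    rw [← Real.exp_add]
    congr 1
    simp only [Finset.sum_sub_distrib, Finset.sum_const, Finset.card_univ, Fintype.card_fin,
      nsmul_eq_mul]
    field_simp
    ring
  simp_rw [key]
  rw [← ofReal_integral_eq_lintegral_ofReal (h5.const_mul _)
    (Filter.Eventually.of_forall fun s => by positivity), integral_const_mul]
  rw [ENNReal.ofReal_le_one]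
  have h6 : ∫ s, Real.exp (lam / S * ∑ i : Fin S, ((∫ w, f w ∂D) - f (s i)))
      ∂(Measure.pi fun _ : Fin S => D) ≤ Real.exp (lam ^ 2 * C ^ 2 / (8 * S)) := by
    refine h4.trans (le_of_eq ?_)
    congr 1
    simp only [Finset.sum_const, Finset.card_univ, Fintype.card_fin, nsmul_eq_mul]
    push_cast
    simp only [sub_zero, Real.norm_eq_abs, div_pow, sq_abs]
    field_simp
    ring
  calc _ ≤ Real.exp (- (lam ^ 2 * C ^ 2 / (8 * S))) * Real.exp (lam ^ 2 * C ^ 2 / (8 * S)) := by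
        gcongr
    _ = 1 := by rw [← Real.exp_add]; simp


/-- PAC-Bayes upper bound on the true cost for randomized controllers. -/
theorem pac_bayes_snoc_upper_bound
    {Θ W : Type*} [MeasurableSpace Θ] [MeasurableSpace W]
    (D : Measure W) [IsProbabilityMeasure D]
    (C : ℝ) (hC : 0 < C)
    (L : Θ × W → ℝ) (hL : Measurable L) (hLb : ∀ θ w, L (θ, w) ∈ Set.Icc 0 C)
    (S : ℕ) (hS : 1 ≤ S)
    (P : Measure Θ) [IsProbabilityMeasure P]
    (Q : Kernel (Fin S → W) Θ) [IsMarkovKernel Q]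
    (hac : ∀ᵐ s ∂(Measure.pi fun _ : Fin S => D), Q s ≪ P)
    (lam : ℝ) (hlam : 0 < lam)
    (δ : ℝ) (hδ : δ ∈ Set.Ioo (0 : ℝ) 1) :
    ENNReal.ofReal (1 - δ) ≤
      ((Measure.pi fun _ : Fin S => D) ⊗ₘ Q)
        {p : (Fin S → W) × Θ |
          (∫ w, L (p.2, w) ∂D) ≤
            (1 / (S : ℝ)) * ∑ s : Fin S, L (p.2, p.1 s)
            + (1 / lam) * Real.log ((Q p.1).rnDeriv P p.2).toReal
            + (1 / lam) * Real.log (1 / δ)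
            + lam * C ^ 2 / (8 * S)} := by
  obtain ⟨hδ0, hδ1⟩ := hδ
  have hS0 : (0 : ℝ) < S := by exact_mod_cast hS
  set μ : Measure (Fin S → W) := Measure.pi fun _ : Fin S => D with hμ
  set A : Set ((Fin S → W) × Θ) := {p : (Fin S → W) × Θ |
          (∫ w, L (p.2, w) ∂D) ≤
            (1 / (S : ℝ)) * ∑ s : Fin S, L (p.2, p.1 s)
            + (1 / lam) * Real.log ((Q p.1).rnDeriv P p.2).toReal
            + (1 / lam) * Real.log (1 / δ)
            + lam * C ^ 2 / (8 * S)} with hA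
  set T := toMeasurable (μ ⊗ₘ Q) A with hT
  have hTm : MeasurableSet T := measurableSet_toMeasurable _ _
  have hAT : A ⊆ T := subset_toMeasurable _ _
  let F : (Fin S → W) → Θ → ENNReal := fun s θ => ENNReal.ofReal (Real.exp
    (lam * ((∫ w, L (θ, w) ∂D) - (1 / (S : ℝ)) * ∑ i : Fin S, L (θ, s i))
      - lam ^ 2 * C ^ 2 / (8 * S)))
  have hFm : Measurable (Function.uncurry F) := by
    have hint : Measurable (fun θ => ∫ w, L (θ, w) ∂D) :=
      (hL.stronglyMeasurable.integral_prod_right' (ν := D)).measurable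
    have hint2 : Measurable (fun p : (Fin S → W) × Θ => ∫ w, L (p.2, w) ∂D) :=
      hint.comp measurable_snd
    have hsum : Measurable (fun p : (Fin S → W) × Θ => ∑ i : Fin S, L (p.2, p.1 i)) := by
      refine Finset.measurable_sum _ fun i _ => hL.comp ?_
      fun_prop
    exact ENNReal.measurable_ofReal.comp (Real.measurable_exp.comp
      (((hint2.sub (hsum.const_mul _)).const_mul _).sub_const _))
  have hF1 : ∫⁻ s, ∫⁻ θ, F s θ ∂P ∂μ ≤ 1 := by
    rw [lintegral_lintegral_swap hFm.aemeasurable]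
    calc ∫⁻ θ, ∫⁻ s, F s θ ∂μ ∂P ≤ ∫⁻ θ, 1 ∂P := lintegral_mono fun θ =>
          pac_hoeffding D C (fun w => L (θ, w)) (hL.comp (by fun_prop)) (hLb θ) S hS lam
      _ = 1 := by simp
  have hpt : ∀ s, ∀ θ, (s, θ) ∉ T → (Q s).rnDeriv P θ < ⊤ →
      (Q s).rnDeriv P θ ≤ ENNReal.ofReal δ * F s θ := by
    intro s θ hθ hfin
    have hnA : (s, θ) ∉ A := fun h => hθ (hAT h)
    rw [hA, Set.mem_setOf_eq, not_le] at hnA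
    simp only at hnA
    by_cases h0 : (Q s).rnDeriv P θ = 0
    · simp [h0]
    have hr : 0 < ((Q s).rnDeriv P θ).toReal := ENNReal.toReal_pos h0 hfin.ne
    rw [← ENNReal.ofReal_toReal hfin.ne, ← ENNReal.ofReal_mul hδ0.le]
    apply ENNReal.ofReal_le_ofReal
    rw [← Real.exp_log hδ0, ← Real.exp_add]
    rw [← Real.log_le_iff_le_exp hr]
    rw [one_div δ, Real.log_inv] at hnA
    have h := mul_lt_mul_of_pos_left hnA hlam
    have e : lam * ((1 / (S : ℝ)) * ∑ i : Fin S, L (θ, s i)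
            + (1 / lam) * Real.log ((Q s).rnDeriv P θ).toReal
            + (1 / lam) * (-Real.log δ)
            + lam * C ^ 2 / (8 * S)) = lam * ((1 / (S : ℝ)) * ∑ i : Fin S, L (θ, s i))
            + Real.log ((Q s).rnDeriv P θ).toReal - Real.log δ + lam ^ 2 * C ^ 2 / (8 * S) := by
      field_simp
      ring
    rw [e] at h
    rw [mul_sub]
    linarith
  have hTc : (μ ⊗ₘ Q) Tᶜ ≤ ENNReal.ofReal δ := by
    rw [Measure.compProd_apply hTm.compl]
    calc ∫⁻ s, Q s (Prod.mk s ⁻¹' Tᶜ) ∂μ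
        ≤ ∫⁻ s, ENNReal.ofReal δ * ∫⁻ θ, F s θ ∂P ∂μ := by
          refine lintegral_mono_ae ?_
          filter_upwards [hac] with s hs
          have hB : MeasurableSet (Prod.mk s ⁻¹' Tᶜ) := measurable_prodMk_left hTm.compl
          rw [← Measure.setLIntegral_rnDeriv hs]
          rw [← lintegral_const_mul' _ _ ENNReal.ofReal_ne_top]
          refine le_trans ?_ (setLIntegral_le_lintegral (Prod.mk s ⁻¹' Tᶜ) _)
          refine lintegral_mono_ae ?_
          filter_upwards [ae_restrict_mem hB,
            ae_restrict_of_ae (Measure.rnDeriv_lt_top (Q s) P)] with θ h1 h2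
          exact hpt s θ h1 h2
      _ = ENNReal.ofReal δ * ∫⁻ s, ∫⁻ θ, F s θ ∂P ∂μ :=
          lintegral_const_mul' _ _ ENNReal.ofReal_ne_top
      _ ≤ ENNReal.ofReal δ * 1 := by gcongr
      _ = ENNReal.ofReal δ := mul_one _
  rw [← measure_toMeasurable A, ← hT]
  have h1 : (μ ⊗ₘ Q) T = 1 - (μ ⊗ₘ Q) Tᶜ := by
    rw [← prob_compl_eq_one_sub hTm.compl, compl_compl]
  rw [h1, ENNReal.ofReal_sub _ hδ0.le, ENNReal.ofReal_one]
  exact tsub_le_tsub_left hTc 1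
end

section
/- Let S ∈ ℕ with S ≥ 1, let P be a probability measure on Θ (independent of the data), and let Q be a Markov kernel from W^S to Θ with Q(S) absolutely continuous with respect to P for D^{⊗S}-almost every dataset S. Then for every λ > 0 and δ ∈ (0,1), with probability at least 1 − δ under the joint law obtained by sampling S ∼ D^{⊗S} and then θ ∼ Q(S), the true cost satisfies 𝓛(θ) ≥ L̂(θ, S) − (1/λ) ln((dQ(S)/dP)(θ)) − (1/λ) ln(1/δ) − λ C² / (8 S). -/
open MeasureTheory ProbabilityTheory

lemma aux_mgf {W : Type*} [MeasurableSpace W]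
    (D : Measure W) [IsProbabilityMeasure D]
    (C : ℝ) (hC : 0 < C) (f : W → ℝ) (hf : Measurable f) (hb : ∀ w, f w ∈ Set.Icc 0 C)
    (S : ℕ) (hS : 1 ≤ S) (lam : ℝ) :
    ∫⁻ s, ENNReal.ofReal (Real.exp (lam * ((1 / (S : ℝ)) * ∑ i : Fin S, f (s i) - ∫ w, f w ∂D)
      - lam ^ 2 * C ^ 2 / (8 * S))) ∂(Measure.pi fun _ : Fin S => D) ≤ 1 := by
  have hS0 : (0 : ℝ) < S := by exact_mod_cast hS
  set μ := (Measure.pi fun _ : Fin S => D) with hμ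
  have hind : iIndepFun (fun (i : Fin S) (s : Fin S → W) => f (s i) - ∫ w, f w ∂D) μ :=
    iIndepFun_pi (X := fun _ w => f w - ∫ w, f w ∂D) (fun i => (hf.sub_const _).aemeasurable)
  have hsub : ∀ i ∈ (Finset.univ : Finset (Fin S)), HasSubgaussianMGF
      (fun (s : Fin S → W) => f (s i) - ∫ w, f w ∂D) ((‖C - 0‖₊ / 2) ^ 2) μ := by
    intro i _
    have h := hasSubgaussianMGF_of_mem_Icc (μ := μ) (X := fun s : Fin S → W => f (s i))
      (a := 0) (b := C) (hf.comp (measurable_pi_apply i)).aemeasurable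
      (Filter.Eventually.of_forall fun s => hb _)
    have he : ∫ s, f (s i) ∂μ = ∫ w, f w ∂D :=
      integral_comp_eval (μ := fun _ : Fin S => D) hf.aestronglyMeasurable
    rwa [he] at h
  have h := HasSubgaussianMGF.sum_of_iIndepFun hind hsub
  have h1 := h.mgf_le (lam / S)
  have h2 := h.integrable_exp_mul (lam / S)
  have key : ∀ s : Fin S → W, Real.exp (lam * ((1 / (S : ℝ)) * ∑ i : Fin S, f (s i) - ∫ w, f w ∂D)
      - lam ^ 2 * C ^ 2 / (8 * S)) = Real.exp (lam / S * ∑ i : Fin S, (f (s i) - ∫ w, f w ∂D))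
        * Real.exp (- (lam ^ 2 * C ^ 2 / (8 * S))) := by
    intro s
    rw [← Real.exp_add]
    congr 1
    simp only [Finset.sum_sub_distrib, Finset.sum_const, Finset.card_univ, Fintype.card_fin,
      nsmul_eq_mul]
    field_simp
    ring
  simp_rw [key]
  rw [← ofReal_integral_eq_lintegral_ofReal (h2.mul_const _)
    (Filter.Eventually.of_forall fun s => by positivity), integral_mul_const]
  rw [ENNReal.ofReal_le_one]
  unfold mgf at h1
  calc _ ≤ _ := mul_le_mul_of_nonneg_right h1 (Real.exp_nonneg _)
    _ = 1 := by
      rw [← Real.exp_add, Real.exp_eq_one_iff]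
      simp [abs_of_pos hC]
      field_simp
      ring

set_option maxHeartbeats 1000000 in
/-- PAC-Bayes lower bound on the true cost for randomized controllers. -/
theorem pac_bayes_snoc_lower_bound
    {Θ W : Type*} [MeasurableSpace Θ] [MeasurableSpace W]
    (D : Measure W) [IsProbabilityMeasure D]
    (C : ℝ) (hC : 0 < C)
    (L : Θ × W → ℝ) (hL : Measurable L) (hLb : ∀ θ w, L (θ, w) ∈ Set.Icc 0 C)
    (S : ℕ) (hS : 1 ≤ S)
    (P : Measure Θ) [IsProbabilityMeasure P]
    (Q : Kernel (Fin S → W) Θ) [IsMarkovKernel Q]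
    (hac : ∀ᵐ s ∂(Measure.pi fun _ : Fin S => D), Q s ≪ P)
    (lam : ℝ) (hlam : 0 < lam)
    (δ : ℝ) (hδ : δ ∈ Set.Ioo (0 : ℝ) 1) :
    ENNReal.ofReal (1 - δ) ≤
      ((Measure.pi fun _ : Fin S => D) ⊗ₘ Q)
        {p : (Fin S → W) × Θ |
          (1 / (S : ℝ)) * ∑ s : Fin S, L (p.2, p.1 s)
            - (1 / lam) * Real.log ((Q p.1).rnDeriv P p.2).toReal
            - (1 / lam) * Real.log (1 / δ)
            - lam * C ^ 2 / (8 * S) ≤ (∫ w, L (p.2, w) ∂D)} := by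
  obtain ⟨hδ0, hδ1⟩ := hδ
  have hS0 : (0 : ℝ) < S := by exact_mod_cast hS
  set μ := (Measure.pi fun _ : Fin S => D) with hμ
  set G := {p : (Fin S → W) × Θ |
          (1 / (S : ℝ)) * ∑ s : Fin S, L (p.2, p.1 s)
            - (1 / lam) * Real.log ((Q p.1).rnDeriv P p.2).toReal
            - (1 / lam) * Real.log (1 / δ)
            - lam * C ^ 2 / (8 * S) ≤ (∫ w, L (p.2, w) ∂D)} with hG
  set T := toMeasurable (μ ⊗ₘ Q) G with hT
  have hTm : MeasurableSet T := measurableSet_toMeasurable _ _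
  have hGT : G ⊆ T := subset_toMeasurable _ _
  rw [← measure_toMeasurable G, ← hT]
  let F : (Fin S → W) → Θ → ENNReal := fun s θ =>
    ENNReal.ofReal (Real.exp (lam * ((1 / (S : ℝ)) * ∑ i : Fin S, L (θ, s i) - ∫ w, L (θ, w) ∂D)
      - lam ^ 2 * C ^ 2 / (8 * S)))
  have hint : Measurable fun θ => ∫ w, L (θ, w) ∂D :=
    (hL.stronglyMeasurable.integral_prod_right' (ν := D)).measurable
  have hF : Measurable (Function.uncurry F) := by
    have h1 : Measurable fun p : (Fin S → W) × Θ => ∫ w, L (p.2, w) ∂D :=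
      hint.comp measurable_snd
    have h2 : Measurable fun p : (Fin S → W) × Θ => ∑ i : Fin S, L (p.2, p.1 i) := by fun_prop
    exact ((((h2.const_mul _).sub h1).const_mul lam).sub_const _).exp.ennreal_ofReal
  have hc : (μ ⊗ₘ Q) Tᶜ ≤ ENNReal.ofReal δ := by
    rw [Measure.compProd_apply hTm.compl]
    calc ∫⁻ s, Q s (Prod.mk s ⁻¹' Tᶜ) ∂μ
        ≤ ∫⁻ s, ∫⁻ θ, ENNReal.ofReal δ * F s θ ∂P ∂μ := by
          apply lintegral_mono_ae
          filter_upwards [hac] with s hs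
          have hB : MeasurableSet (Prod.mk s ⁻¹' Tᶜ) := measurable_prodMk_left hTm.compl
          rw [← Measure.setLIntegral_rnDeriv hs]
          refine le_trans ?_ (setLIntegral_le_lintegral (Prod.mk s ⁻¹' Tᶜ) _)
          apply lintegral_mono_ae
          filter_upwards [ae_restrict_mem hB, ae_restrict_of_ae (Measure.rnDeriv_lt_top (Q s) P)]
            with θ hθ hfin
          have hnG : (s, θ) ∉ G := fun h => hθ (hGT h)
          simp only [hG, Set.mem_ofPred_eq, not_le] at hnG
          rw [← ENNReal.ofReal_toReal hfin.ne, ← ENNReal.ofReal_mul hδ0.le]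
          apply ENNReal.ofReal_le_ofReal
          rcases (ENNReal.toReal_nonneg (a := (Q s).rnDeriv P θ)).eq_or_lt with h0 | h0
          · rw [← h0]; positivity
          · rw [← Real.log_le_log_iff h0 (by positivity),
              Real.log_mul hδ0.ne' (Real.exp_ne_zero _), Real.log_exp]
            rw [one_div δ, Real.log_inv] at hnG
            have h3 := mul_lt_mul_of_pos_left hnG hlam
            have h4 : ∀ A l d : ℝ, lam * (A - 1 / lam * l - 1 / lam * -d - lam * C ^ 2 / (8 * S))
                = lam * A - l + d - lam ^ 2 * C ^ 2 / (8 * S) := by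
              intro A l d
              field_simp
              ring
            rw [h4] at h3
            linarith
      _ = ∫⁻ θ, ∫⁻ s, ENNReal.ofReal δ * F s θ ∂μ ∂P :=
          lintegral_lintegral_swap (hF.const_mul _).aemeasurable
      _ ≤ ∫⁻ θ, ENNReal.ofReal δ ∂P := by
          apply lintegral_mono
          intro θ
          have hm : Measurable fun s => F s θ := hF.of_uncurry_right
          simp only
          rw [lintegral_const_mul _ hm]
          exact mul_le_of_le_one_right zero_le (aux_mgf D C hC (fun w => L (θ, w))
            (hL.comp measurable_prodMk_left) (hLb θ) S hS lam)
      _ = ENNReal.ofReal δ := by simp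
  rw [ENNReal.ofReal_sub _ hδ0.le, ENNReal.ofReal_one, tsub_le_iff_right]
  calc (1 : ENNReal) = (μ ⊗ₘ Q) T + (μ ⊗ₘ Q) Tᶜ := by
        rw [measure_add_measure_compl hTm, measure_univ]
    _ ≤ _ := by gcongr
end

section
/- Let S ∈ ℕ with S ≥ 1, let P be a probability measure on Θ (independent of the data), and let λ > 0. Let Q* be the Markov kernel from W^S to Θ defined by dQ*(S)/dP (θ) = exp(−λ L̂(θ, S)) / Z_λ(P, S), where Z_λ(P, S) = E_{θ ∼ P} exp(−λ L̂(θ, S)). Then for every δ ∈ (0,1), with probability at least 1 − δ under the joint law obtained by sampling S ∼ D^{⊗S} and then θ ∼ Q*(S), the true cost satisfies 𝓛(θ) ≤ −(1/λ) ln Z_λ(P, S) + (1/λ) ln(1/δ) + λ C² / (8 S). -/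
open MeasureTheory ProbabilityTheory

lemma pb_single {W : Type*} [MeasurableSpace W] (D : Measure W) [IsProbabilityMeasure D]
    (C : ℝ) (hC : 0 < C) (f : W → ℝ) (hf : Measurable f) (hb : ∀ w, f w ∈ Set.Icc 0 C) (t : ℝ) :
    Integrable (fun w => Real.exp (t * (f w - ∫ x, f x ∂D))) D ∧
    ∫ w, Real.exp (t * (f w - ∫ x, f x ∂D)) ∂D ≤ Real.exp (C ^ 2 * t ^ 2 / 8) := by
  have h := hasSubgaussianMGF_of_mem_Icc (μ := D) (X := f) hf.aemeasurable
    (Filter.Eventually.of_forall hb)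
  refine ⟨h.integrable_exp_mul t, (h.mgf_le t).trans (le_of_eq ?_)⟩
  congr 1
  simp [abs_of_pos hC]
  ring

lemma pb_pi {W : Type*} [MeasurableSpace W] (D : Measure W) [IsProbabilityMeasure D]
    (C : ℝ) (hC : 0 < C) (f : W → ℝ) (hf : Measurable f) (hb : ∀ w, f w ∈ Set.Icc 0 C)
    (S : ℕ) (hS : 1 ≤ S) (lam : ℝ) :
    ∫⁻ d, ENNReal.ofReal (Real.exp (-lam * ((1 / (S : ℝ)) * ∑ s : Fin S, f (d s))
      + lam * (∫ x, f x ∂D) - lam ^ 2 * C ^ 2 / (8 * S))) ∂(Measure.pi fun _ : Fin S => D)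
      ≤ 1 := by
  have hS0 : (S : ℝ) ≠ 0 := by positivity
  obtain ⟨hi, hle⟩ := pb_single D C hC f hf hb (-lam / S)
  set m := ∫ x, f x ∂D with hm
  set F : W → ℝ := fun w => Real.exp ((-lam / S) * (f w - m)) *
        Real.exp (-(C ^ 2 * (-lam / S) ^ 2 / 8)) with hF
  have key : ∀ d : Fin S → W, Real.exp (-lam * ((1 / (S : ℝ)) *
      ∑ s : Fin S, f (d s)) + lam * m - lam ^ 2 * C ^ 2 / (8 * S)) = ∏ s : Fin S, F (d s) := by
    intro d
    simp_rw [hF, ← Real.exp_add]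
    rw [← Real.exp_sum]
    congr 1
    rw [Finset.sum_add_distrib, ← Finset.mul_sum, Finset.sum_sub_distrib]
    simp
    field_simp
    ring
  simp_rw [key]
  have hFi : Integrable F D := hi.mul_const _
  have hF0 : ∀ w, 0 ≤ F w := fun w => by positivity
  rw [← ofReal_integral_eq_lintegral_ofReal (Integrable.fintype_prod fun _ => hFi)
    (Filter.Eventually.of_forall fun d => Finset.prod_nonneg fun _ _ => hF0 _),
    integral_fintype_prod_eq_prod (fun _ : Fin S => F), ENNReal.ofReal_le_one]
  refine Finset.prod_le_one (fun _ _ => integral_nonneg hF0) fun _ _ => ?_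
  rw [hF, integral_mul_const]
  refine (mul_le_mul_of_nonneg_right hle (Real.exp_pos _).le).trans ?_
  rw [← Real.exp_add]
  simp

/-- PAC-Bayes upper bound on the true cost for the optimal Gibbs posterior. -/
theorem pac_bayes_upper_bound_gibbs_posterior
    {Θ W : Type*} [MeasurableSpace Θ] [MeasurableSpace W]
    (D : Measure W) [IsProbabilityMeasure D]
    (C : ℝ) (hC : 0 < C)
    (L : Θ × W → ℝ) (hL : Measurable L) (hLb : ∀ θ w, L (θ, w) ∈ Set.Icc 0 C)
    (S : ℕ) (hS : 1 ≤ S)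
    (P : Measure Θ) [IsProbabilityMeasure P]
    (lam : ℝ) (hlam : 0 < lam)
    (Qstar : Kernel (Fin S → W) Θ) [IsMarkovKernel Qstar]
    (hQ : ∀ data : Fin S → W,
      Qstar data = P.withDensity fun θ => ENNReal.ofReal
        (Real.exp (-lam * ((1 / (S : ℝ)) * ∑ s : Fin S, L (θ, data s))) /
          ∫ θ', Real.exp (-lam * ((1 / (S : ℝ)) * ∑ s : Fin S, L (θ', data s))) ∂P))
    (δ : ℝ) (hδ : δ ∈ Set.Ioo (0 : ℝ) 1) :
    ENNReal.ofReal (1 - δ) ≤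
      ((Measure.pi fun _ : Fin S => D) ⊗ₘ Qstar)
        {p : (Fin S → W) × Θ |
          (∫ w, L (p.2, w) ∂D) ≤
            -(1 / lam) * Real.log
              (∫ θ', Real.exp (-lam * ((1 / (S : ℝ)) * ∑ s : Fin S, L (θ', p.1 s))) ∂P)
            + (1 / lam) * Real.log (1 / δ)
            + lam * C ^ 2 / (8 * S)} := by
  have hS0 : (0 : ℝ) < S := by positivity
  set Z : (Fin S → W) → ℝ := fun d =>
    ∫ θ', Real.exp (-lam * ((1 / (S : ℝ)) * ∑ s : Fin S, L (θ', d s))) ∂P with hZ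
  set R : Θ → ℝ := fun θ => ∫ w, L (θ, w) ∂D with hR
  have hJ : Measurable fun p : (Fin S → W) × Θ =>
      -lam * ((1 / (S : ℝ)) * ∑ s : Fin S, L (p.2, p.1 s)) := by
    refine Measurable.const_mul (Measurable.const_mul ?_ _) _
    refine Finset.measurable_sum _ fun s _ => hL.comp ?_
    exact measurable_snd.prodMk ((measurable_pi_apply s).comp measurable_fst)
  have hRm : Measurable R :=
    (hL.stronglyMeasurable.integral_prod_right' (ν := D)).measurable
  have hZm : Measurable Z :=
    ((hJ.exp).stronglyMeasurable.integral_prod_right' (ν := P)).measurable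
  have hZpos : ∀ d, 0 < Z d := by
    intro d
    refine integral_exp_pos ?_
    refine Integrable.of_mem_Icc 0 1 ?_ (Filter.Eventually.of_forall fun θ => ⟨(Real.exp_pos _).le, ?_⟩)
    · exact ((hJ.comp (measurable_const.prodMk measurable_id)).exp).aemeasurable
    · rw [Real.exp_le_one_iff]
      have : 0 ≤ ∑ s : Fin S, L (θ, d s) := Finset.sum_nonneg fun s _ => (hLb _ _).1
      have : 0 ≤ lam * ((1 / (S : ℝ)) * ∑ s : Fin S, L (θ, d s)) := by positivity
      linarith
  set c : ℝ := lam ^ 2 * C ^ 2 / (8 * S) with hc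
  set μ := (Measure.pi fun _ : Fin S => D) with hμ
  set g : (Fin S → W) × Θ → ENNReal := fun p =>
    ENNReal.ofReal (Z p.1 * Real.exp (lam * R p.2 - c)) with hg
  have hgm : Measurable g := by
    have h1 : Measurable fun p : (Fin S → W) × Θ => Z p.1 := hZm.comp measurable_fst
    have h2 : Measurable fun p : (Fin S → W) × Θ => R p.2 := hRm.comp measurable_snd
    exact (h1.mul ((h2.const_mul lam).sub_const c).exp).ennreal_ofReal
  have hint : ∫⁻ p, g p ∂(μ ⊗ₘ Qstar) ≤ 1 := by
    rw [Measure.lintegral_compProd hgm]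
    have h1 : ∀ d, ∫⁻ θ, g (d, θ) ∂(Qstar d) = ∫⁻ θ, ENNReal.ofReal (Real.exp
        (-lam * ((1 / (S : ℝ)) * ∑ s : Fin S, L (θ, d s)) + lam * R θ - c)) ∂P := by
      intro d
      have hJd : Measurable fun θ : Θ => -lam * ((1 / (S : ℝ)) * ∑ s : Fin S, L (θ, d s)) :=
        hJ.comp (measurable_const.prodMk measurable_id)
      have hgd : Measurable fun θ : Θ => g (d, θ) :=
        hgm.comp (measurable_const.prodMk measurable_id)
      rw [hQ, lintegral_withDensity_eq_lintegral_mul _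
        ((hJd.exp.div_const _).ennreal_ofReal) hgd]
      refine lintegral_congr fun θ => ?_
      have hz := hZpos d
      simp only [Pi.mul_apply, hg]
      change ENNReal.ofReal (_ / Z d) * _ = _
      rw [← ENNReal.ofReal_mul (by positivity), add_sub_assoc, Real.exp_add]
      congr 1
      field_simp
    simp_rw [h1]
    rw [lintegral_lintegral_swap]
    · calc _ ≤ ∫⁻ θ, 1 ∂P := lintegral_mono fun θ =>
            pb_pi D C hC (fun w => L (θ, w)) (hL.comp (measurable_const.prodMk measurable_id))
              (hLb θ) S hS lam
        _ = 1 := by simp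
    · have h2 : Measurable fun p : (Fin S → W) × Θ => R p.2 := hRm.comp measurable_snd
      exact (((hJ.add (h2.const_mul lam)).sub_const c).exp.ennreal_ofReal).aemeasurable
  have hB : (μ ⊗ₘ Qstar) {p | ENNReal.ofReal (1 / δ) ≤ g p} ≤ ENNReal.ofReal δ := by
    have hd := hδ.1
    refine (meas_ge_le_lintegral_div hgm.aemeasurable (by simpa using hd)
      ENNReal.ofReal_ne_top).trans ?_
    refine (ENNReal.div_le_div_right hint _).trans ?_
    rw [one_div, one_div, ENNReal.ofReal_inv_of_pos hd, inv_inv]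
  have hBm : MeasurableSet {p | ENNReal.ofReal (1 / δ) ≤ g p} :=
    measurableSet_le measurable_const hgm
  calc ENNReal.ofReal (1 - δ) = 1 - ENNReal.ofReal δ := by
        rw [ENNReal.ofReal_sub _ hδ.1.le, ENNReal.ofReal_one]
    _ ≤ 1 - (μ ⊗ₘ Qstar) {p | ENNReal.ofReal (1 / δ) ≤ g p} := tsub_le_tsub_left hB _
    _ = (μ ⊗ₘ Qstar) {p | ENNReal.ofReal (1 / δ) ≤ g p}ᶜ := (prob_compl_eq_one_sub hBm).symm
    _ ≤ _ := by
      refine measure_mono fun p hp => ?_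
      simp only [Set.mem_compl_iff, Set.mem_ofPred_eq, not_le, hg] at hp
      have hd := hδ.1
      have hz := hZpos p.1
      have h3 := (ENNReal.ofReal_lt_ofReal_iff (by positivity)).1 hp
      have h4 := Real.log_lt_log (by positivity) h3
      rw [Real.log_mul hz.ne' (Real.exp_pos _).ne', Real.log_exp] at h4
      change R p.2 ≤ -(1 / lam) * Real.log (Z p.1) + _ + _
      have h5 : lam * C ^ 2 / (8 * S) = (1 / lam) * c := by rw [hc]; field_simp
      rw [h5]
      have h6 : R p.2 = (1 / lam) * (lam * R p.2) := by field_simp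
      rw [h6]
      have : (1 / lam) * (lam * R p.2) ≤ (1 / lam) * (-Real.log (Z p.1) + Real.log (1 / δ) + c) :=
        mul_le_mul_of_nonneg_left (by linarith) (by positivity)
      linarith
end

section
/- Let S ∈ ℕ with S ≥ 1, let P be a probability measure on Θ (independent of the data), and let λ > 0. Let Q* be the Markov kernel from W^S to Θ defined by dQ*(S)/dP (θ) = exp(−λ L̂(θ, S)) / Z_λ(P, S), where Z_λ(P, S) = E_{θ ∼ P} exp(−λ L̂(θ, S)). Then for every δ ∈ (0,1), with probability at least 1 − δ under the joint law obtained by sampling S ∼ D^{⊗S} and then θ ∼ Q*(S), the true cost satisfies 𝓛(θ) ≥ 2 L̂(θ, S) + (1/λ) ln Z_λ(P, S) − (1/λ) ln(1/δ) − λ C² / (8 S). -/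
open MeasureTheory ProbabilityTheory

/-- Hoeffding bound for the exponential moment of the empirical average. -/
lemma hoeffding_aux {W : Type*} [MeasurableSpace W] (D : Measure W) [IsProbabilityMeasure D]
    (C : ℝ) (hC : 0 < C) (f : W → ℝ) (hf : Measurable f) (hfb : ∀ w, f w ∈ Set.Icc 0 C)
    (S : ℕ) (hS : 1 ≤ S) (lam : ℝ) :
    ∫⁻ data : Fin S → W, ENNReal.ofReal (Real.exp (lam * ((1 / (S : ℝ)) * ∑ s : Fin S, f (data s))
      - lam ^ 2 * C ^ 2 / (8 * S) - lam * ∫ w, f w ∂D)) ∂(Measure.pi fun _ : Fin S => D) ≤ 1 := by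
  have hS0 : (0 : ℝ) < S := by exact_mod_cast hS
  have hsub := (hasSubgaussianMGF_of_mem_Icc (μ := D) (X := f) hf.aemeasurable
    (Filter.Eventually.of_forall hfb))
  have hm := hsub.mgf_le (lam / S)
  have hi := hsub.integrable_exp_mul (lam / S)
  set m := ∫ w, f w ∂D with hmdef
  have hfac : ∀ data : Fin S → W, Real.exp (lam * ((1 / (S : ℝ)) * ∑ s : Fin S, f (data s))
      - lam ^ 2 * C ^ 2 / (8 * S) - lam * m)
      = Real.exp (- (lam ^ 2 * C ^ 2 / (8 * S))) *
        ∏ s : Fin S, Real.exp (lam / S * (f (data s) - m)) := by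
    intro data
    rw [← Real.exp_sum, ← Real.exp_add, ← Finset.mul_sum, Finset.sum_sub_distrib]
    congr 1
    simp
    field_simp
    ring
  simp_rw [hfac]
  rw [← ofReal_integral_eq_lintegral_ofReal]
  · rw [integral_const_mul,
      integral_fintype_prod_eq_prod (fun (_ : Fin S) w => Real.exp (lam / S * (f w - m)))]
    rw [← ENNReal.ofReal_one]
    apply ENNReal.ofReal_le_ofReal
    simp only [Finset.prod_const, Finset.card_univ, Fintype.card_fin]
    have h1 : (∫ w, Real.exp (lam / S * (f w - m)) ∂D) ^ S ≤
        Real.exp (lam ^ 2 * C ^ 2 / (8 * S)) := by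
      calc _ ≤ (Real.exp (C ^ 2 / 4 * (lam / S) ^ 2 / 2)) ^ S := by
            apply pow_le_pow_left₀ (by positivity)
            refine hm.trans (le_of_eq ?_)
            congr 3
            simp [abs_of_pos hC]
            ring
        _ = _ := by
            rw [← Real.exp_nat_mul]
            congr 1
            field_simp
            ring
    calc _ ≤ Real.exp (- (lam ^ 2 * C ^ 2 / (8 * S))) * Real.exp (lam ^ 2 * C ^ 2 / (8 * S)) := by
          gcongr
      _ = 1 := by rw [← Real.exp_add]; simp
  · exact (Integrable.fintype_prod (f := fun (_ : Fin S) w => Real.exp (lam / S * (f w - m)))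
      (fun _ => hi)).const_mul _
  · exact Filter.Eventually.of_forall fun _ => by positivity

/-- PAC-Bayes lower bound on the true cost for the optimal Gibbs posterior. -/
theorem pac_bayes_lower_bound_gibbs_posterior
    {Θ W : Type*} [MeasurableSpace Θ] [MeasurableSpace W]
    (D : Measure W) [IsProbabilityMeasure D]
    (C : ℝ) (hC : 0 < C)
    (L : Θ × W → ℝ) (hL : Measurable L) (hLb : ∀ θ w, L (θ, w) ∈ Set.Icc 0 C)
    (S : ℕ) (hS : 1 ≤ S)
    (P : Measure Θ) [IsProbabilityMeasure P]
    (lam : ℝ) (hlam : 0 < lam)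
    (Qstar : Kernel (Fin S → W) Θ) [IsMarkovKernel Qstar]
    (hQ : ∀ data : Fin S → W,
      Qstar data = P.withDensity fun θ => ENNReal.ofReal
        (Real.exp (-lam * ((1 / (S : ℝ)) * ∑ s : Fin S, L (θ, data s))) /
          ∫ θ', Real.exp (-lam * ((1 / (S : ℝ)) * ∑ s : Fin S, L (θ', data s))) ∂P))
    (δ : ℝ) (hδ : δ ∈ Set.Ioo (0 : ℝ) 1) :
    ENNReal.ofReal (1 - δ) ≤
      ((Measure.pi fun _ : Fin S => D) ⊗ₘ Qstar)
        {p : (Fin S → W) × Θ |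
          2 * ((1 / (S : ℝ)) * ∑ s : Fin S, L (p.2, p.1 s))
            + (1 / lam) * Real.log
              (∫ θ', Real.exp (-lam * ((1 / (S : ℝ)) * ∑ s : Fin S, L (θ', p.1 s))) ∂P)
            - (1 / lam) * Real.log (1 / δ)
            - lam * C ^ 2 / (8 * S) ≤ (∫ w, L (p.2, w) ∂D)} := by
  obtain ⟨hδ0, hδ1⟩ := hδ
  have hS0 : (0 : ℝ) < S := by exact_mod_cast hS
  set μ := Measure.pi fun _ : Fin S => D with hμ
  let Lh : (Fin S → W) → Θ → ℝ := fun d θ => (1 / (S : ℝ)) * ∑ s : Fin S, L (θ, d s)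
  let Z : (Fin S → W) → ℝ := fun d => ∫ θ', Real.exp (-lam * Lh d θ') ∂P
  let T : Θ → ℝ := fun θ => ∫ w, L (θ, w) ∂D
  have hLh : Measurable (fun p : (Fin S → W) × Θ => Lh p.1 p.2) := by
    apply Measurable.const_mul
    apply Finset.measurable_sum
    intro s _
    exact hL.comp (measurable_snd.prodMk ((measurable_pi_apply s).comp measurable_fst))
  have hLh0 : ∀ d θ, 0 ≤ Lh d θ := fun d θ =>
    mul_nonneg (by positivity) (Finset.sum_nonneg fun s _ => (hLb _ _).1)
  have hE : Measurable (fun p : (Fin S → W) × Θ => Real.exp (-lam * Lh p.1 p.2)) :=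
    (hLh.const_mul _).exp
  have hZm : Measurable Z := (hE.stronglyMeasurable.integral_prod_right' (ν := P)).measurable
  have hTm : Measurable T := (hL.stronglyMeasurable.integral_prod_right' (ν := D)).measurable
  have hZpos : ∀ d, 0 < Z d := by
    intro d
    apply integral_exp_pos
    refine Integrable.of_bound (C := 1) (hE.comp measurable_prodMk_left).aestronglyMeasurable ?_
    refine Filter.Eventually.of_forall fun θ => ?_
    rw [Real.norm_eq_abs, abs_of_pos (Real.exp_pos _)]
    apply Real.exp_le_one_iff.2
    have := mul_nonneg hlam.le (hLh0 d θ)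
    linarith
  let G : (Fin S → W) × Θ → ℝ := fun p => 2 * lam * Lh p.1 p.2 + Real.log (Z p.1)
    - lam ^ 2 * C ^ 2 / (8 * S) - lam * T p.2
  have hG : Measurable G :=
    (((hLh.const_mul _).add (hZm.comp measurable_fst).log).sub_const _).sub
      ((hTm.comp measurable_snd).const_mul _)
  have hF : Measurable (fun p => ENNReal.ofReal (Real.exp (G p))) := hG.exp.ennreal_ofReal
  have hQ' : ∀ d, Qstar d = P.withDensity fun θ => ENNReal.ofReal
      (Real.exp (-lam * Lh d θ) / Z d) := hQ
  have key : ∫⁻ p, ENNReal.ofReal (Real.exp (G p)) ∂(μ ⊗ₘ Qstar) ≤ 1 := by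
    rw [Measure.lintegral_compProd hF]
    have h1 : ∀ d, ∫⁻ θ, ENNReal.ofReal (Real.exp (G (d, θ))) ∂(Qstar d)
        = ∫⁻ θ, ENNReal.ofReal (Real.exp (lam * Lh d θ - lam ^ 2 * C ^ 2 / (8 * S)
          - lam * T θ)) ∂P := by
      intro d
      have hm1 : Measurable fun θ => ENNReal.ofReal (Real.exp (-lam * Lh d θ) / Z d) :=
        ((hE.comp measurable_prodMk_left).div_const _).ennreal_ofReal
      have hm2 : Measurable fun θ => ENNReal.ofReal (Real.exp (G (d, θ))) :=
        hF.comp measurable_prodMk_left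
      rw [hQ', lintegral_withDensity_eq_lintegral_mul _ hm1 hm2]
      refine lintegral_congr fun θ => ?_
      simp only [Pi.mul_apply]
      rw [← ENNReal.ofReal_mul (div_nonneg (Real.exp_pos _).le (hZpos d).le)]
      congr 1
      have hz : Z d = Real.exp (Real.log (Z d)) := (Real.exp_log (hZpos d)).symm
      conv_lhs => enter [1, 2]; rw [hz]
      rw [← Real.exp_sub, ← Real.exp_add]
      congr 1
      simp only [G]
      ring
    simp_rw [h1]
    rw [lintegral_lintegral_swap]
    · calc _ ≤ ∫⁻ θ, 1 ∂P := lintegral_mono fun θ =>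
            hoeffding_aux D C hC (fun w => L (θ, w)) (hL.comp measurable_prodMk_left)
              (hLb θ) S hS lam
        _ = 1 := by simp
    · exact (((hLh.const_mul _).sub_const _).sub
        ((hTm.comp measurable_snd).const_mul _)).exp.ennreal_ofReal.aemeasurable
  have hmk := (mul_meas_ge_le_lintegral hF (μ := μ ⊗ₘ Qstar) (ENNReal.ofReal (1 / δ))).trans key
  have hbad : (μ ⊗ₘ Qstar) {p | ENNReal.ofReal (1 / δ) ≤ ENNReal.ofReal (Real.exp (G p))}
      ≤ ENNReal.ofReal δ := by
    calc _ = ENNReal.ofReal δ * (ENNReal.ofReal (1 / δ) * (μ ⊗ₘ Qstar)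
          {p | ENNReal.ofReal (1 / δ) ≤ ENNReal.ofReal (Real.exp (G p))}) := by
          rw [← mul_assoc, ← ENNReal.ofReal_mul hδ0.le, mul_one_div_cancel hδ0.ne']
          simp
      _ ≤ ENNReal.ofReal δ * 1 := by gcongr
      _ = _ := mul_one _
  have hBm : MeasurableSet {p | ENNReal.ofReal (1 / δ) ≤ ENNReal.ofReal (Real.exp (G p))} :=
    measurableSet_le measurable_const hF
  calc ENNReal.ofReal (1 - δ) = 1 - ENNReal.ofReal δ := by
        rw [ENNReal.ofReal_sub _ hδ0.le, ENNReal.ofReal_one]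
    _ ≤ 1 - (μ ⊗ₘ Qstar) {p | ENNReal.ofReal (1 / δ) ≤ ENNReal.ofReal (Real.exp (G p))} :=
        tsub_le_tsub_left hbad _
    _ = (μ ⊗ₘ Qstar) {p | ENNReal.ofReal (1 / δ) ≤ ENNReal.ofReal (Real.exp (G p))}ᶜ :=
        (prob_compl_eq_one_sub hBm).symm
    _ ≤ _ := by
        apply measure_mono
        intro p hp
        simp only [Set.mem_compl_iff, Set.mem_ofPred_eq, not_le] at hp
        have h2 := (ENNReal.ofReal_lt_ofReal_iff (by positivity)).1 hp
        have h3 := (Real.lt_log_iff_exp_lt (by positivity)).2 h2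
        change 2 * Lh p.1 p.2 + (1 / lam) * Real.log (Z p.1) - (1 / lam) * Real.log (1 / δ)
          - lam * C ^ 2 / (8 * S) ≤ T p.2
        have h4 : lam * (2 * Lh p.1 p.2 + (1 / lam) * Real.log (Z p.1)
          - (1 / lam) * Real.log (1 / δ) - lam * C ^ 2 / (8 * S) - T p.2)
          = G p - Real.log (1 / δ) := by
          simp only [G]
          field_simp
          ring
        by_contra hcon
        push Not at hcon
        have := mul_pos hlam (sub_pos.2 hcon)
        linarith
end

section
/- Let W be a measurable space with probability measure D, Θ a measurable space, C > 0, and L : Θ × W → [0, C] jointly measurable. Let S₁, S₂ ∈ ℕ with S₁, S₂ ≥ 1, set S = S₁ + S₂, and fix disjoint datasets S₁ = (w¹, …, w^{S₁}) ∈ W^{S₁} and S₂ = (v¹, …, v^{S₂}) ∈ W^{S₂} whose concatenation is S ∈ W^S. Fix λ > 0 and set λ₁ = (S₁/S) λ and λ₂ = (S₂/S) λ. Let P be a probability measure on Θ, define Q₁ by dQ₁/dP (θ) = exp(−λ₁ L̂(θ, S₁)) / Z_{λ₁}(P, S₁), and define Q₂ by dQ₂/dQ₁ (θ) = exp(−λ₂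 L̂(θ, S₂)) / Z_{λ₂}(Q₁, S₂). Then Q₂ equals the Gibbs distribution Q* with dQ*/dP (θ) = exp(−λ L̂(θ, S)) / Z_λ(P, S). -/
open MeasureTheory

lemma gibbs_aux {Θ : Type*} [MeasurableSpace Θ] (P : Measure Θ) [IsProbabilityMeasure P]
    (f g h : Θ → ℝ) (hf : Measurable f) (hg : Measurable g)
    (hf0 : ∀ θ, 0 < f θ) (hf1 : ∀ θ, f θ ≤ 1) (hh : ∀ θ, f θ * g θ = h θ) :
    (P.withDensity fun θ => ENNReal.ofReal (f θ / ∫ θ', f θ' ∂P)).withDensity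
      (fun θ => ENNReal.ofReal (g θ / ∫ θ', g θ'
        ∂(P.withDensity fun θ => ENNReal.ofReal (f θ / ∫ θ', f θ' ∂P))))
    = P.withDensity fun θ => ENNReal.ofReal (h θ / ∫ θ', h θ' ∂P) := by
  have hint : Integrable f P := by
    refine Integrable.of_bound hf.aestronglyMeasurable 1 (Filter.Eventually.of_forall fun θ => ?_)
    rw [Real.norm_eq_abs, abs_of_pos (hf0 θ)]
    exact hf1 θ
  have hZ : 0 < ∫ θ', f θ' ∂P := by
    rw [integral_pos_iff_support_of_nonneg (fun θ => (hf0 θ).le) hint]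
    have : Function.support f = Set.univ := by
      ext θ
      simp [(hf0 θ).ne']
    rw [this]
    simp
  set Z := ∫ θ', f θ' ∂P with hZdef
  have hm : Measurable fun θ => ENNReal.ofReal (f θ / Z) := (hf.div_const Z).ennreal_ofReal
  have hI : ∫ θ', g θ' ∂(P.withDensity fun θ => ENNReal.ofReal (f θ / Z))
      = (∫ θ', h θ' ∂P) / Z := by
    rw [integral_withDensity_eq_integral_toReal_smul hm (by simp), ← integral_div]
    refine integral_congr_ae (Filter.Eventually.of_forall fun θ => ?_)
    simp only [smul_eq_mul]
    rw [ENNReal.toReal_ofReal (div_pos (hf0 θ) hZ).le, ← hh]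
    ring
  rw [hI, ← withDensity_mul _ hm ((hg.div_const _).ennreal_ofReal)]
  congr 1
  ext θ
  simp only [Pi.mul_apply]
  rw [← ENNReal.ofReal_mul (div_pos (hf0 θ) hZ).le, ← hh]
  congr 1
  field_simp

/-- Two-stage Gibbs inference reproduces the single-stage optimal Gibbs posterior. -/
theorem two_stage_gibbs_posterior
    {Θ W : Type*} [MeasurableSpace Θ] [MeasurableSpace W]
    (C : ℝ) (hC : 0 < C)
    (L : Θ × W → ℝ) (hL : Measurable L) (hLb : ∀ θ w, L (θ, w) ∈ Set.Icc 0 C)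
    (S1 S2 : ℕ) (hS1 : 1 ≤ S1) (hS2 : 1 ≤ S2)
    (data1 : Fin S1 → W) (data2 : Fin S2 → W)
    (data : Fin (S1 + S2) → W) (hdata : data = Fin.append data1 data2)
    (lam : ℝ) (hlam : 0 < lam)
    (P : Measure Θ) [IsProbabilityMeasure P] :
    let S : ℕ := S1 + S2
    let lam1 : ℝ := ((S1 : ℝ) / (S : ℝ)) * lam
    let lam2 : ℝ := ((S2 : ℝ) / (S : ℝ)) * lam
    let Lhat1 : Θ → ℝ := fun θ => (1 / (S1 : ℝ)) * ∑ s : Fin S1, L (θ, data1 s)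
    let Lhat2 : Θ → ℝ := fun θ => (1 / (S2 : ℝ)) * ∑ s : Fin S2, L (θ, data2 s)
    let Lhat : Θ → ℝ := fun θ => (1 / (S : ℝ)) * ∑ s : Fin (S1 + S2), L (θ, data s)
    let Q1 : Measure Θ := P.withDensity fun θ =>
      ENNReal.ofReal (Real.exp (-lam1 * Lhat1 θ) / ∫ θ', Real.exp (-lam1 * Lhat1 θ') ∂P)
    let Q2 : Measure Θ := Q1.withDensity fun θ =>
      ENNReal.ofReal (Real.exp (-lam2 * Lhat2 θ) / ∫ θ', Real.exp (-lam2 * Lhat2 θ') ∂Q1)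
    Q2 = P.withDensity fun θ =>
      ENNReal.ofReal (Real.exp (-lam * Lhat θ) / ∫ θ', Real.exp (-lam * Lhat θ') ∂P) := by
  intro S lam1 lam2 Lhat1 Lhat2 Lhat Q1 Q2
  have h1 : (0 : ℝ) < S1 := by exact_mod_cast hS1
  have h2 : (0 : ℝ) < S2 := by exact_mod_cast hS2
  have hS : (0 : ℝ) < S := by
    simp only [S]
    push_cast
    positivity
  have hm : ∀ w, Measurable fun θ => L (θ, w) := fun w => hL.comp (by fun_prop)
  have m1 : Measurable Lhat1 :=
    (Finset.measurable_fun_sum _ fun s _ => hm (data1 s)).const_mul _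
  have m2 : Measurable Lhat2 :=
    (Finset.measurable_fun_sum _ fun s _ => hm (data2 s)).const_mul _
  refine gibbs_aux P _ _ _ (m1.const_mul _).exp (m2.const_mul _).exp
    (fun θ => Real.exp_pos _) (fun θ => ?_) (fun θ => ?_)
  · rw [Real.exp_le_one_iff, neg_mul, neg_nonpos]
    have : 0 ≤ ∑ s : Fin S1, L (θ, data1 s) := Finset.sum_nonneg fun s _ => (hLb _ _).1
    simp only [lam1, Lhat1]
    positivity
  · rw [← Real.exp_add]
    congr 1
    simp only [lam1, lam2, Lhat1, Lhat2, Lhat, hdata, Fin.sum_univ_add, Fin.append_left,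
      Fin.append_right]
    field_simp
    ring
end

section
/- Let λ > 0, C > 0, N ∈ ℕ with N ≥ 1, and f : Θ → [0, C]. Define φ : Θ^N → ℝ by φ(θ₁, …, θ_N) = ln( (1/N) Σ_{n=1}^N exp(−λ f(θ_n)) ). Then φ satisfies the bounded-difference condition with constant ln(1 + (exp(λC) − 1)/N): for every n ∈ {1, …, N}, every (θ₁, …, θ_N) ∈ Θ^N, and every θ_n' ∈ Θ, |φ(θ₁, …, θ_n, …, θ_N) − φ(θ₁, …, θ_n', …, θ_N)| ≤ ln(1 + (exp(λC) − 1)/N). -/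
theorem log_avg_aux (N : ℕ) (hN : 1 ≤ N) (K : ℝ) (hK : 0 ≤ K) (a b : Fin N → ℝ) (n : Fin N)
    (ha : ∀ m, a m ∈ Set.Icc (Real.exp (-K)) 1) (hb : ∀ m, b m ∈ Set.Icc (Real.exp (-K)) 1)
    (hab : ∀ m, m ≠ n → a m = b m) :
    Real.log ((1 / (N : ℝ)) * ∑ m, a m) - Real.log ((1 / (N : ℝ)) * ∑ m, b m)
      ≤ Real.log (1 + (Real.exp K - 1) / N) := by
  have hNp : (0 : ℝ) < N := by exact_mod_cast hN
  have he : 0 < Real.exp (-K) := Real.exp_pos _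
  have hE : 1 ≤ Real.exp K := Real.one_le_exp hK
  have hEe : Real.exp K * Real.exp (-K) = 1 := by rw [← Real.exp_add]; simp
  have low : ∀ c : Fin N → ℝ, (∀ m, c m ∈ Set.Icc (Real.exp (-K)) 1) →
      N * Real.exp (-K) ≤ ∑ m, c m := by
    intro c hc
    have := Finset.card_nsmul_le_sum Finset.univ c (Real.exp (-K)) (fun m _ => (hc m).1)
    simpa using this
  have hA := low a ha
  have hB := low b hb
  have hdiff : ∑ m, a m - ∑ m, b m = a n - b n := by
    rw [← Finset.sum_sub_distrib]
    apply Finset.sum_eq_single n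
    · intro m _ hm
      rw [hab m hm, sub_self]
    · simp
  have hd : ∑ m, a m - ∑ m, b m ≤ 1 - Real.exp (-K) := by
    rw [hdiff]; linarith [(ha n).2, (hb n).1]
  have hNe : 0 < N * Real.exp (-K) := by positivity
  have hApos : 0 < ∑ m, a m := by linarith
  have hBpos : 0 < ∑ m, b m := by linarith
  have hq : 0 ≤ (Real.exp K - 1) / N := div_nonneg (by linarith) hNp.le
  have h1 : (Real.exp K - 1) / N * (N * Real.exp (-K)) = 1 - Real.exp (-K) := by
    field_simp
    linarith
  have h2 := mul_le_mul_of_nonneg_left hB hq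
  rw [sub_le_iff_le_add, ← Real.log_mul (by positivity) (by positivity)]
  apply Real.log_le_log (by positivity)
  have h3 : ∑ m, a m ≤ (1 + (Real.exp K - 1) / N) * ∑ m, b m := by linarith
  calc (1 / (N : ℝ)) * ∑ m, a m ≤ (1 / (N : ℝ)) * ((1 + (Real.exp K - 1) / N) * ∑ m, b m) := by
        gcongr
    _ = _ := by ring

/-- Bounded-difference property of the log Monte Carlo partition-function estimate. -/
theorem log_monte_carlo_partition_bounded_difference
    {Θ : Type*} (lam C : ℝ) (hlam : 0 < lam) (hC : 0 < C)
    (N : ℕ) (hN : 1 ≤ N)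
    (f : Θ → ℝ) (hfb : ∀ θ, f θ ∈ Set.Icc 0 C) :
    ∀ (n : Fin N) (θs : Fin N → Θ) (θ' : Θ),
      |Real.log ((1 / (N : ℝ)) * ∑ m : Fin N, Real.exp (-lam * f (θs m)))
        - Real.log ((1 / (N : ℝ)) *
            ∑ m : Fin N, Real.exp (-lam * f (Function.update θs n θ' m)))|
      ≤ Real.log (1 + (Real.exp (lam * C) - 1) / N) := by
  intro n θs θ'
  have hr : ∀ θ, Real.exp (-lam * f θ) ∈ Set.Icc (Real.exp (-(lam * C))) 1 := by
    intro θ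
    obtain ⟨h0, h1⟩ := hfb θ
    constructor
    · apply Real.exp_le_exp.2
      nlinarith
    · apply Real.exp_le_one_iff.2
      nlinarith
  have hu : ∀ m, m ≠ n → Function.update θs n θ' m = θs m :=
    fun m hm => Function.update_of_ne hm _ _
  rw [abs_sub_le_iff]
  constructor
  · exact log_avg_aux N hN (lam * C) (by positivity) _ _ n (fun m => hr _) (fun m => hr _)
      (fun m hm => by simp only [hu m hm])
  · exact log_avg_aux N hN (lam * C) (by positivity) _ _ n (fun m => hr _) (fun m => hr _)
      (fun m hm => by simp only [hu m hm])
end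

section
/- Let P be a probability measure on Θ, λ > 0, C > 0, δ ∈ (0,1), N ∈ ℕ with N ≥ 1, and f : Θ → [0, C] measurable. Let Ẑ(θ₁, …, θ_N) = (1/N) Σ_{n=1}^N exp(−λ f(θ_n)) and Z = E_{θ ∼ P} exp(−λ f(θ)). Then P^{⊗N}[ ln Ẑ(θ₁, …, θ_N) − ln Z ≥ ln(1 + (exp(λC) − 1)/N) · √( (N/2) ln(1/δ) ) ] ≤ δ. -/
open MeasureTheory

lemma aux_measurable_cons {Θ : Type*} [MeasurableSpace Θ] (N : ℕ) :
    Measurable (fun z : Θ × (Fin N → Θ) => (Fin.cons z.1 z.2 : Fin (N + 1) → Θ)) := by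
  rw [measurable_pi_iff]
  intro i
  refine Fin.cases ?_ (fun j => ?_) i
  · simpa using measurable_fst
  · simp only [Fin.cons_succ]
    fun_prop

lemma aux_integrable {Ω : Type*} [MeasurableSpace Ω] (μ : Measure Ω) [IsFiniteMeasure μ]
    {F : Ω → ℝ} (hF : Measurable F) {K : ℝ} (hK : ∀ x, |F x| ≤ K) : Integrable F μ :=
  Integrable.of_bound hF.aestronglyMeasurable K (Filter.Eventually.of_forall hK)

lemma aux_integral_cons {Θ : Type*} [MeasurableSpace Θ]
    (P : Measure Θ) [IsProbabilityMeasure P] (N : ℕ)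
    (F : (Fin (N + 1) → Θ) → ℝ) (hF : Measurable F) (K : ℝ) (hK : ∀ x, |F x| ≤ K) :
    ∫ x, F x ∂(Measure.pi fun _ : Fin (N + 1) => P)
      = ∫ y, ∫ x, F (Fin.cons x y) ∂P ∂(Measure.pi fun _ : Fin N => P) := by
  have h := ((measurePreserving_piFinSuccAbove (fun _ : Fin (N + 1) => P) 0).symm).integral_comp' F
  rw [← h]
  have e : ∀ z : Θ × (Fin N → Θ),
      (MeasurableEquiv.piFinSuccAbove (fun _ : Fin (N + 1) => Θ) 0).symm z = Fin.cons z.1 z.2 := by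
    intro z
    simp [MeasurableEquiv.piFinSuccAbove_symm_apply, Fin.insertNthEquiv]
  have h2 : ∀ z : Θ × (Fin N → Θ),
      F ((MeasurableEquiv.piFinSuccAbove (fun _ : Fin (N + 1) => Θ) 0).symm z)
        = F (Fin.cons z.1 z.2) := fun z => by rw [e]
  refine (integral_congr_ae (Filter.Eventually.of_forall h2)).trans ?_
  exact integral_prod_symm (fun z : Θ × (Fin N → Θ) => F (Fin.cons z.1 z.2))
    (aux_integrable _ (hF.comp (aux_measurable_cons N)) fun z => hK _)

lemma aux_mgf_s14 {Θ : Type*} [MeasurableSpace Θ]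
    (P : Measure Θ) [IsProbabilityMeasure P] (c : ℝ) (hc : 0 ≤ c) (M : ℝ) (t : ℝ) (N : ℕ) :
    ∀ (g : (Fin N → Θ) → ℝ), Measurable g → (∀ x, |g x| ≤ M) →
    (∀ x i z, g x - g (Function.update x i z) ≤ c) →
    ∫ x, Real.exp (t * (g x - ∫ y, g y ∂(Measure.pi fun _ : Fin N => P)))
      ∂(Measure.pi fun _ : Fin N => P) ≤ Real.exp (N * (c / 2) ^ 2 * t ^ 2 / 2) := by
  induction N with
  | zero =>
    intro g hg hM hd
    have : ∀ x, g x = g default := fun x => by rw [Subsingleton.elim x default]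
    simp [this]
  | succ N ih =>
    intro g hg hM hd
    have : Nonempty Θ := P.nonempty_of_neZero
    have hgc : Measurable (fun z : Θ × (Fin N → Θ) => g (Fin.cons z.1 z.2)) :=
      hg.comp (aux_measurable_cons N)
    have hgx : ∀ y : Fin N → Θ, Measurable (fun x : Θ => g (Fin.cons x y)) := fun y =>
      hgc.comp (measurable_id.prodMk measurable_const)
    have hgi : ∀ y : Fin N → Θ, Integrable (fun x : Θ => g (Fin.cons x y)) P := fun y =>
      aux_integrable P (hgx y) fun x => hM _
    set h : (Fin N → Θ) → ℝ := fun y => ∫ x, g (Fin.cons x y) ∂P with hh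
    have hhm : Measurable h :=
      (hgc.stronglyMeasurable.integral_prod_left').measurable
    have hhM : ∀ y, |h y| ≤ M := fun y => by
      have := norm_integral_le_of_norm_le_const (μ := P) (f := fun x => g (Fin.cons x y)) (C := M)
        (Filter.Eventually.of_forall fun x => hM _)
      simpa using this
    have hhd : ∀ x i z, h x - h (Function.update x i z) ≤ c := fun y i z => by
      simp only [hh]
      rw [← integral_sub (hgi _) (hgi _)]
      have : ∫ x, (g (Fin.cons x y) - g (Fin.cons x (Function.update y i z))) ∂P
          ≤ ∫ x, c ∂P := by
        refine integral_mono ((hgi _).sub (hgi _)) (integrable_const c) fun x => ?_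
        simp only [Fin.cons_update]
        exact hd _ _ _
      simpa using this
    have key := ih h hhm hhM hhd
    have hE : ∫ y, g y ∂(Measure.pi fun _ : Fin (N + 1) => P)
        = ∫ y, h y ∂(Measure.pi fun _ : Fin N => P) := aux_integral_cons P N g hg M hM
    rw [hE]
    set m := ∫ y, h y ∂(Measure.pi fun _ : Fin N => P) with hm
    have expb : ∀ a : ℝ, |a| ≤ M → |Real.exp (t * (a - m))| ≤ Real.exp (|t| * (M + |m|)) := by
      intro a ha
      rw [Real.abs_exp, Real.exp_le_exp]
      calc t * (a - m) ≤ |t * (a - m)| := le_abs_self _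
        _ = |t| * |a - m| := abs_mul _ _
        _ ≤ |t| * (M + |m|) := by
          gcongr
          exact (abs_sub _ _).trans (by gcongr)
    rw [aux_integral_cons P N (fun x => Real.exp (t * (g x - m))) (by fun_prop)
      (Real.exp (|t| * (M + |m|))) (fun x => expb _ (hM x))]
    have hoef : ∀ y : Fin N → Θ, ∫ x, Real.exp (t * (g (Fin.cons x y) - h y)) ∂P
        ≤ Real.exp ((c / 2) ^ 2 * t ^ 2 / 2) := by
      intro y
      have hbd : BddBelow (Set.range fun x : Θ => g (Fin.cons x y)) :=
        ⟨-M, by rintro _ ⟨x, rfl⟩; exact (abs_le.1 (hM _)).1⟩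
      have := (ProbabilityTheory.hasSubgaussianMGF_of_mem_Icc (μ := P)
        (X := fun x => g (Fin.cons x y)) (a := ⨅ x : Θ, g (Fin.cons x y))
        (b := (⨅ x : Θ, g (Fin.cons x y)) + c) (hgx y).aemeasurable
        (Filter.Eventually.of_forall fun x => ⟨ciInf_le hbd x, by
          rw [← sub_le_iff_le_add]
          refine le_ciInf fun x' => ?_
          have := hd (Fin.cons x y) 0 x'
          rw [Fin.update_cons_zero] at this
          linarith⟩)).mgf_le t
      simpa [ProbabilityTheory.mgf, abs_of_nonneg hc] using this
    calc ∫ y, ∫ x, Real.exp (t * (g (Fin.cons x y) - m)) ∂P ∂(Measure.pi fun _ : Fin N => P)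
        ≤ ∫ y, Real.exp ((c / 2) ^ 2 * t ^ 2 / 2) * Real.exp (t * (h y - m))
            ∂(Measure.pi fun _ : Fin N => P) := by
          refine integral_mono_of_nonneg
            (Filter.Eventually.of_forall fun y => integral_nonneg fun x => (Real.exp_pos _).le)
            ((aux_integrable _ (F := fun y => Real.exp (t * (h y - m))) (by fun_prop)
              (fun y => expb _ (hhM y))).const_mul _)
            (Filter.Eventually.of_forall fun y => ?_)
          have : ∀ x, Real.exp (t * (g (Fin.cons x y) - m))
              = Real.exp (t * (g (Fin.cons x y) - h y)) * Real.exp (t * (h y - m)) := fun x => by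
            rw [← Real.exp_add]; ring_nf
          simp only [this]
          rw [integral_mul_const]
          exact mul_le_mul_of_nonneg_right (hoef y) (Real.exp_pos _).le
      _ ≤ Real.exp ((c / 2) ^ 2 * t ^ 2 / 2) * Real.exp (N * (c / 2) ^ 2 * t ^ 2 / 2) := by
          rw [integral_const_mul]
          exact mul_le_mul_of_nonneg_left key (Real.exp_pos _).le
      _ = _ := by
          rw [← Real.exp_add]; push_cast; ring_nf

lemma aux_mcdiarmid {Θ : Type*} [MeasurableSpace Θ]
    (P : Measure Θ) [IsProbabilityMeasure P] (c : ℝ) (hc : 0 ≤ c) (M : ℝ) (N : ℕ)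
    (g : (Fin N → Θ) → ℝ) (hg : Measurable g) (hM : ∀ x, |g x| ≤ M)
    (hd : ∀ x i z, g x - g (Function.update x i z) ≤ c) (ε : ℝ) (hε : 0 ≤ ε) :
    (Measure.pi fun _ : Fin N => P).real
      {x | ε ≤ g x - ∫ y, g y ∂(Measure.pi fun _ : Fin N => P)}
      ≤ Real.exp (-ε ^ 2 / (2 * (N * (c / 2) ^ 2))) := by
  have hs : ProbabilityTheory.HasSubgaussianMGF
      (fun x => g x - ∫ y, g y ∂(Measure.pi fun _ : Fin N => P))
      (N * (c.toNNReal / 2) ^ 2) (Measure.pi fun _ : Fin N => P) := by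
    refine ⟨fun t => ?_, fun t => ?_⟩
    · set m := ∫ y, g y ∂(Measure.pi fun _ : Fin N => P) with hm
      refine aux_integrable _ (K := Real.exp (|t| * (M + |m|))) (by fun_prop) fun x => ?_
      rw [Real.abs_exp, Real.exp_le_exp]
      calc t * (g x - m) ≤ |t * (g x - m)| := le_abs_self _
        _ = |t| * |g x - m| := abs_mul _ _
        _ ≤ |t| * (M + |m|) := by
          gcongr
          exact (abs_sub _ _).trans (by gcongr; exact hM x)
    · have := aux_mgf_s14 P c hc M t N g hg hM hd
      simpa [ProbabilityTheory.mgf, hc] using this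
  simpa [hc] using hs.measure_ge_le hε

/-- McDiarmid concentration for the log Monte Carlo estimate of the partition function:
the probability of overestimating `ln Z` by the McDiarmid margin is at most `δ`. -/
theorem log_monte_carlo_partition_concentration
    {Θ : Type*} [MeasurableSpace Θ]
    (P : Measure Θ) [IsProbabilityMeasure P]
    (lam C : ℝ) (hlam : 0 < lam) (hC : 0 < C)
    (δ : ℝ) (hδ : δ ∈ Set.Ioo (0 : ℝ) 1)
    (N : ℕ) (hN : 1 ≤ N)
    (f : Θ → ℝ) (hf : Measurable f) (hfb : ∀ θ, f θ ∈ Set.Icc 0 C) :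
    (Measure.pi fun _ : Fin N => P)
      {θs : Fin N → Θ |
        Real.log ((1 / (N : ℝ)) * ∑ n : Fin N, Real.exp (-lam * f (θs n)))
          - Real.log (∫ θ, Real.exp (-lam * f θ) ∂P)
        ≥ Real.log (1 + (Real.exp (lam * C) - 1) / N) *
            Real.sqrt (((N : ℝ) / 2) * Real.log (1 / δ))}
      ≤ ENNReal.ofReal δ := by
  obtain ⟨hδ0, hδ1⟩ := hδ
  have hN0 : (0 : ℝ) < N := by exact_mod_cast hN
  set b := Real.exp (-lam * C) with hb
  have hb0 : 0 < b := Real.exp_pos _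
  have hbC : Real.exp (lam * C) = 1 / b := by
    rw [hb, neg_mul, Real.exp_neg]; simp
  have hlc : 1 < Real.exp (lam * C) := Real.one_lt_exp_iff.2 (by positivity)
  have hw1 : ∀ θ, Real.exp (-lam * f θ) ≤ 1 := fun θ => by
    rw [Real.exp_le_one_iff]; nlinarith [(hfb θ).1]
  have hwb : ∀ θ, b ≤ Real.exp (-lam * f θ) := fun θ => by
    rw [hb, Real.exp_le_exp]; nlinarith [(hfb θ).2]
  have hwm : Measurable fun θ => Real.exp (-lam * f θ) := by fun_prop
  generalize hw : (fun θ => Real.exp (-lam * f θ)) = w at hwm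
  have hw' : ∀ θ, Real.exp (-lam * f θ) = w θ := fun θ => by rw [← hw]
  simp only [hw'] at hw1 hwb ⊢
  set c := Real.log (1 + (Real.exp (lam * C) - 1) / N) with hcdef
  have hq : 0 < (Real.exp (lam * C) - 1) / N := div_pos (by linarith) hN0
  have hc : 0 < c := Real.log_pos (by linarith)
  set A : (Fin N → Θ) → ℝ := fun θs => (1 / (N : ℝ)) * ∑ n : Fin N, w (θs n) with hA
  have hAb : ∀ x, b ≤ A x := fun x => by
    have : ∑ n : Fin N, b ≤ ∑ n : Fin N, w (x n) := Finset.sum_le_sum fun n _ => hwb _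
    simp at this
    simp only [hA]
    rw [one_div_mul_eq_div, le_div_iff₀ hN0]
    linarith
  have hA1 : ∀ x, A x ≤ 1 := fun x => by
    have : ∑ n : Fin N, w (x n) ≤ ∑ n : Fin N, (1 : ℝ) := Finset.sum_le_sum fun n _ => hw1 _
    simp at this
    simp only [hA]
    rw [one_div_mul_eq_div, div_le_iff₀ hN0]
    linarith
  have hA0 : ∀ x, 0 < A x := fun x => hb0.trans_le (hAb x)
  have hAm : Measurable A := by
    simp only [hA]
    fun_prop
  have hd : ∀ x i z, Real.log (A x) - Real.log (A (Function.update x i z)) ≤ c := by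
    intro x i z
    rw [← Real.log_div (hA0 _).ne' (hA0 _).ne']
    refine Real.log_le_log (div_pos (hA0 _) (hA0 _)) ?_
    set A' := A (Function.update x i z) with hA'
    have hdiff : A x - A' = (w (x i) - w z) / N := by
      simp only [hA', hA]
      rw [← mul_sub, ← Finset.sum_sub_distrib, Finset.sum_eq_single i]
      · simp; ring
      · intro j _ hj; simp [Function.update_of_ne hj]
      · simp
    have h1 : A x ≤ A' + (1 - b) / N := by
      have : (w (x i) - w z) / N ≤ (1 - b) / N := by
        gcongr
        · exact hw1 _
        · exact hwb _
      linarith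
    have hA'b : b ≤ A' := hAb _
    rw [div_le_iff₀ (hA0 _), hbC]
    have : (1 - b) / N ≤ (1 / b - 1) / N * A' := by
      have e : (1 - b) / N = (1 / b - 1) / N * b := by field_simp
      rw [e]
      refine mul_le_mul_of_nonneg_left hA'b ?_
      rw [← hbC]; exact hq.le
    linarith
  have hM : ∀ x, |Real.log (A x)| ≤ lam * C := fun x => by
    rw [abs_le]
    constructor
    · rw [← neg_mul, ← Real.log_exp (-lam * C)]
      exact Real.log_le_log hb0 (hAb x)
    · exact (Real.log_nonpos (hA0 x).le (hA1 x)).trans (by positivity)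
  have hwi : Integrable w P := aux_integrable P hwm (K := 1) fun x => by
    rw [abs_of_pos (hb0.trans_le (hwb x))]; exact hw1 x
  set Z := ∫ θ, w θ ∂P with hZ
  have hZ0 : 0 < Z := by
    have : ∫ θ, b ∂P ≤ Z := integral_mono (integrable_const b) hwi hwb
    simp at this
    linarith
  have hAi : Integrable A (Measure.pi fun _ : Fin N => P) :=
    aux_integrable _ hAm (K := 1) fun x => by rw [abs_of_pos (hA0 x)]; exact hA1 x
  have hAZ : ∫ x, A x ∂(Measure.pi fun _ : Fin N => P) = Z := by
    simp only [hA]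
    rw [integral_const_mul, integral_finsetSum]
    · have : ∀ i : Fin N, ∫ x : Fin N → Θ, w (x i) ∂(Measure.pi fun _ : Fin N => P) = Z :=
        fun i => integral_comp_eval (μ := fun _ : Fin N => P) (i := i) hwm.aestronglyMeasurable
      simp [this]
      field_simp
    · intro i _
      exact aux_integrable _ (hwm.comp (measurable_pi_apply i)) (K := 1) fun x => by
        show |w (x i)| ≤ 1
        rw [abs_of_pos (hb0.trans_le (hwb _))]; exact hw1 _
  have hLm : Measurable fun x => Real.log (A x) := Real.measurable_log.comp hAm
  have jensen : ∫ x, Real.log (A x) ∂(Measure.pi fun _ : Fin N => P) ≤ Real.log Z := by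
    have h1 : ∫ x, Real.log (A x) ∂(Measure.pi fun _ : Fin N => P)
        ≤ ∫ x, (A x / Z + (Real.log Z - 1)) ∂(Measure.pi fun _ : Fin N => P) := by
      refine integral_mono (aux_integrable _ hLm hM)
        ((hAi.div_const Z).add (integrable_const _)) fun x => ?_
      have := Real.log_le_sub_one_of_pos (div_pos (hA0 x) hZ0)
      rw [Real.log_div (hA0 x).ne' hZ0.ne'] at this
      simp only
      linarith
    rw [integral_add (hAi.div_const Z) (integrable_const _), integral_div, hAZ,
      div_self hZ0.ne'] at h1
    simp at h1
    linarith
  have hlog : 0 < Real.log (1 / δ) := Real.log_pos (by rw [lt_div_iff₀ hδ0]; linarith)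
  have main := aux_mcdiarmid P c hc.le (lam * C) N (fun x => Real.log (A x)) hLm hM hd
    (c * Real.sqrt (((N : ℝ) / 2) * Real.log (1 / δ))) (by positivity)
  have hexp : Real.exp (-(c * Real.sqrt (((N : ℝ) / 2) * Real.log (1 / δ))) ^ 2
      / (2 * (N * (c / 2) ^ 2))) = δ := by
    rw [mul_pow, Real.sq_sqrt (by positivity)]
    have : -(c ^ 2 * ((N : ℝ) / 2 * Real.log (1 / δ))) / (2 * (N * (c / 2) ^ 2))
        = - Real.log (1 / δ) := by
      field_simp
      try ring
    rw [this, one_div, Real.log_inv, neg_neg, Real.exp_log hδ0]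
  rw [hexp] at main
  refine (measure_mono ?_).trans
    ((ENNReal.le_ofReal_iff_toReal_le (measure_ne_top _ _) hδ0.le).2 main)
  intro x hx
  simp only [Set.mem_ofPred_eq, ge_iff_le] at hx ⊢
  linarith
end

section
/- Let S, N_P ∈ ℕ with S, N_P ≥ 1, let P be a probability measure on Θ, and let λ > 0, C > 0, δ ∈ (0,1). Let Q* be the Markov kernel from W^S to Θ with dQ*(S)/dP (θ) = exp(−λ L̂(θ, S)) / Z_λ(P, S), and let Ẑ_λ(θ₁, …, θ_{N_P}, S) = (1/N_P) Σ_{n=1}^{N_P} exp(−λ L̂(θ_n, S)). Then, with probability at least 1 − 2δ under the joint law obtained by independently sampling S ∼ D^{⊗S}, θ ∼ Q*(S), and (θ₁, …, θ_{N_P}) ∼ P^{⊗N_P}, the true cost satisfies 𝓛(θ) ≥ 2 L̂(θ, S) + (1/λ) ln Ẑ_λ(θ₁, …, θ_{N_P}, S) − (1/λ) ln(1/δ) − λ C² / (8 S) − (1/λ) ln(1 + (exp(λC) − 1)/N_P) · √( (N_P/2) ln(1/δ) ). -/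
open MeasureTheory ProbabilityTheory

lemma aux_int {Ω : Type*} [MeasurableSpace Ω] (μ : Measure Ω) [IsProbabilityMeasure μ]
    (f : Ω → ℝ) (hf : Measurable f) (B : ℝ) (hB : ∀ x, |f x| ≤ B) : Integrable f μ :=
  Integrable.of_bound hf.aestronglyMeasurable B (Filter.Eventually.of_forall (by simpa using hB))

lemma aux_int_exp {Ω : Type*} [MeasurableSpace Ω] (μ : Measure Ω) [IsProbabilityMeasure μ]
    (f : Ω → ℝ) (hf : Measurable f) (B : ℝ) (hB : ∀ x, |f x| ≤ B) (t : ℝ) :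
    Integrable (fun x => Real.exp (t * f x)) μ := by
  refine aux_int μ _ (by fun_prop) (Real.exp (|t| * B)) fun x => ?_
  rw [Real.abs_exp, Real.exp_le_exp]
  calc t * f x ≤ |t * f x| := le_abs_self _
    _ = |t| * |f x| := abs_mul _ _
    _ ≤ _ := mul_le_mul_of_nonneg_left (hB x) (abs_nonneg _)

lemma hoeff {Ω : Type*} [MeasurableSpace Ω] (μ : Measure Ω) [IsProbabilityMeasure μ]
    (g : Ω → ℝ) (hg : Measurable g) (B : ℝ) (hB : ∀ x, |g x| ≤ B) (c : ℝ)
    (hc : ∀ x y, g x - g y ≤ c) (t : ℝ) :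
    ∫ x, Real.exp (t * g x) ∂μ ≤ Real.exp (t * ∫ x, g x ∂μ + t ^ 2 * c ^ 2 / 8) := by
  have hne : Nonempty Ω := nonempty_of_isProbabilityMeasure μ
  have hbdd : BddBelow (Set.range g) :=
    ⟨-B, by rintro _ ⟨x, rfl⟩; exact (abs_le.1 (hB x)).1⟩
  set m := ⨅ x, g x
  have hm : ∀ x, g x ∈ Set.Icc m (m + c) := fun x =>
    ⟨ciInf_le hbdd x, by
      have : g x - c ≤ m := le_ciInf fun y => by linarith [hc x y]
      linarith⟩
  have h := (hasSubgaussianMGF_of_mem_Icc (μ := μ) hg.aemeasurable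
    (Filter.Eventually.of_forall hm)).mgf_le t
  simp only [mgf, add_sub_cancel_left] at h
  have e : ∀ x, Real.exp (t * g x) =
      Real.exp (t * ∫ x, g x ∂μ) * Real.exp (t * (g x - ∫ x, g x ∂μ)) := fun x => by
    rw [← Real.exp_add]; ring_nf
  simp_rw [e, integral_const_mul]
  rw [Real.exp_add]
  refine mul_le_mul_of_nonneg_left (h.trans ?_) (Real.exp_pos _).le
  rw [Real.exp_le_exp]
  simp only [NNReal.coe_pow, NNReal.coe_div, coe_nnnorm, NNReal.coe_ofNat, Real.norm_eq_abs]
  rw [div_pow, sq_abs]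
  linarith

lemma mcd {Ω : Type*} [MeasurableSpace Ω] (μ : Measure Ω) [IsProbabilityMeasure μ]
    (c t B : ℝ) : ∀ (n : ℕ) (f : (Fin n → Ω) → ℝ), Measurable f → (∀ x, |f x| ≤ B) → 
    (∀ x i y, f (Function.update x i y) - f x ≤ c) →
    ∫ x, Real.exp (t * f x) ∂(Measure.pi fun _ : Fin n => μ) ≤
      Real.exp (t * ∫ x, f x ∂(Measure.pi fun _ : Fin n => μ) + t ^ 2 * (n * c ^ 2) / 8) := by
  intro n
  induction n with
  | zero =>
    intro f hf hB hc
    have : ∀ x : Fin 0 → Ω, f x = f default := fun x => by rw [Subsingleton.elim x default]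
    simp_rw [this]
    simp
  | succ n ih =>
    intro f hf hB hc
    have mp := (measurePreserving_piFinSuccAbove (fun _ : Fin (n+1) => μ) 0).symm
    have hco : ∀ (a : Ω) (x : Fin n → Ω),
        (MeasurableEquiv.piFinSuccAbove (fun _ : Fin (n+1) => Ω) 0).symm (a, x) = Fin.cons a x :=
      fun a x => by
        change Fin.insertNth (α := fun _ => Ω) 0 a x = _
        rw [Fin.insertNth_zero]; rfl
    have key : ∀ h : (Fin (n+1) → Ω) → ℝ, Integrable h (Measure.pi fun _ : Fin (n+1) => μ) →
        ∫ x, h x ∂(Measure.pi fun _ : Fin (n+1) => μ) =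
        ∫ a, ∫ x, h (Fin.cons a x) ∂(Measure.pi fun _ : Fin n => μ) ∂μ := by
      intro h hh
      rw [← mp.integral_comp (MeasurableEquiv.measurableEmbedding _), integral_prod]
      · simp_rw [hco]
      · exact (mp.integrable_comp_emb (MeasurableEquiv.measurableEmbedding _)).2 hh
    have hcm : Measurable (fun p : Ω × (Fin n → Ω) => (Fin.cons p.1 p.2 : Fin (n+1) → Ω)) := by
      simp_rw [← hco]
      exact (MeasurableEquiv.piFinSuccAbove (fun _ : Fin (n+1) => Ω) 0).symm.measurable
    have hfm : Measurable (fun p : Ω × (Fin n → Ω) => f (Fin.cons p.1 p.2)) := hf.comp hcm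
    have hfa : ∀ a, Measurable (fun x : Fin n → Ω => f (Fin.cons a x)) := fun a =>
      hfm.comp measurable_prodMk_left
    rw [key _ (aux_int_exp _ f hf B hB t), key _ (aux_int _ f hf B hB)]
    set ν := Measure.pi fun _ : Fin n => μ
    set g : Ω → ℝ := fun a => ∫ x, f (Fin.cons a x) ∂ν with hgdef
    have hgm : Measurable g := (hfm.stronglyMeasurable.integral_prod_right).measurable
    have hgi : ∀ a, Integrable (fun x : Fin n → Ω => f (Fin.cons a x)) ν := fun a =>
      aux_int _ _ (hfa a) B fun x => hB _
    have hgB : ∀ a, |g a| ≤ B := fun a => by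
      have := norm_integral_le_of_norm_le_const (μ := ν) (f := fun x => f (Fin.cons a x)) (C := B)
        (Filter.Eventually.of_forall fun x => hB _)
      simpa using this
    have hgc : ∀ a b, g a - g b ≤ c := fun a b => by
      simp only [hgdef]
      rw [← integral_sub (hgi a) (hgi b)]
      have : ∫ x, (f (Fin.cons a x) - f (Fin.cons b x)) ∂ν ≤ ∫ x, c ∂ν := by
        refine integral_mono ((hgi a).sub (hgi b)) (integrable_const _) fun x => ?_
        have := hc (Fin.cons b x) 0 a
        rwa [Fin.update_cons_zero] at this
      simpa using this
    have h1 := hoeff μ g hgm B hgB c hgc t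
    have h2 : ∀ a, ∫ x, Real.exp (t * f (Fin.cons a x)) ∂ν ≤
        Real.exp (t ^ 2 * (n * c^2) / 8) * Real.exp (t * g a) := fun a => by
      rw [← Real.exp_add, add_comm (t ^ 2 * (n * c^2) / 8)]
      refine ih (fun x => f (Fin.cons a x)) (hfa a) (fun x => hB _) fun x i y => ?_
      rw [Fin.cons_update]; exact hc _ _ _
    have hem : Measurable (fun p : Ω × (Fin n → Ω) => Real.exp (t * f (Fin.cons p.1 p.2))) := by
      fun_prop
    calc _ ≤ ∫ a, Real.exp (t ^ 2 * (n * c^2) / 8) * Real.exp (t * g a) ∂μ := by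
          refine integral_mono_of_nonneg
            (Filter.Eventually.of_forall fun a => integral_nonneg fun x => (Real.exp_pos _).le)
            ((aux_int_exp _ g hgm B hgB t).const_mul _) (Filter.Eventually.of_forall h2)
      _ ≤ Real.exp (t ^ 2 * (n * c^2) / 8) * Real.exp (t * ∫ x, g x ∂μ + t ^ 2 * c ^ 2 / 8) := by
          rw [integral_const_mul]
          exact mul_le_mul_of_nonneg_left h1 (Real.exp_pos _).le
      _ = _ := by
          rw [← Real.exp_add]; congr 1; push_cast; ring

lemma chern {Ω : Type*} [MeasurableSpace Ω] (μ : Measure Ω) [IsProbabilityMeasure μ]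
    (c B : ℝ) (hc0 : 0 < c) (n : ℕ) (hn : 1 ≤ n) (f : (Fin n → Ω) → ℝ) (hf : Measurable f)
    (hB : ∀ x, |f x| ≤ B) (hc : ∀ x i y, f (Function.update x i y) - f x ≤ c)
    (δ : ℝ) (hδ : δ ∈ Set.Ioo (0 : ℝ) 1) :
    (Measure.pi fun _ : Fin n => μ) {x | ∫ x, f x ∂(Measure.pi fun _ : Fin n => μ) +
      c * Real.sqrt ((n : ℝ) / 2 * Real.log (1 / δ)) ≤ f x} ≤ ENNReal.ofReal δ := by
  set ν := Measure.pi fun _ : Fin n => μ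
  set l := Real.log (1 / δ) with hl
  have hl0 : 0 ≤ l := Real.log_nonneg (by rw [le_div_iff₀ hδ.1]; linarith [hδ.2])
  set r := Real.sqrt ((n : ℝ) / 2 * l) with hr
  have hn0 : (0:ℝ) < n := by exact_mod_cast hn
  have hr2 : r ^ 2 = n / 2 * l := Real.sq_sqrt (by positivity)
  have hr0 : 0 ≤ r := Real.sqrt_nonneg _
  set t := 4 * r / (n * c) with ht
  have h1 := measure_ge_le_exp_mul_mgf (μ := ν) (X := f) (∫ x, f x ∂ν + c * r) (t := t)
    (by positivity) (aux_int_exp ν f hf B hB t)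
  have h2 := mcd μ c t B n f hf hB hc
  rw [← ofReal_measureReal]
  refine ENNReal.ofReal_le_ofReal (h1.trans ?_)
  calc _ ≤ Real.exp (-t * (∫ x, f x ∂ν + c * r)) *
        Real.exp (t * ∫ x, f x ∂ν + t ^ 2 * (n * c ^ 2) / 8) :=
        mul_le_mul_of_nonneg_left h2 (Real.exp_pos _).le
    _ = Real.exp (-l) := by
        rw [← Real.exp_add]; congr 1
        have : t * c = 4 * r / n := by rw [ht]; field_simp
        have e : -t * (∫ x, f x ∂ν + c * r) + (t * ∫ x, f x ∂ν + t ^ 2 * (n * c ^ 2) / 8)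
          = - (t * c) * r + (t * c) ^ 2 * n / 8 := by ring
        rw [e, this]
        have : -(4 * r / n) * r + (4 * r / n) ^ 2 * n / 8 = - 2 * r ^ 2 / n := by field_simp; ring
        rw [this, hr2]; field_simp
    _ ≤ δ := by
        rw [hl, one_div, Real.log_inv, neg_neg, Real.exp_log hδ.1]

lemma sum_upd {Ω : Type*} {n : ℕ} (φ : Ω → ℝ) (x : Fin n → Ω) (i : Fin n) (y : Ω) :
    ∑ j, φ (Function.update x i y j) - ∑ j, φ (x j) = φ y - φ (x i) := by
  rw [← Finset.sum_sub_distrib, Finset.sum_eq_single i]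
  · simp
  · intro j _ hj; simp [Function.update_of_ne hj]
  · simp

lemma mcZ {Θ : Type*} [MeasurableSpace Θ] (P : Measure Θ) [IsProbabilityMeasure P]
    (C : ℝ) (hC : 0 < C) (h : Θ → ℝ) (hh : Measurable h) (hb : ∀ θ, h θ ∈ Set.Icc 0 C)
    (N : ℕ) (hN : 1 ≤ N) (lam : ℝ) (hlam : 0 < lam)
    (δ : ℝ) (hδ : δ ∈ Set.Ioo (0 : ℝ) 1) :
    (Measure.pi fun _ : Fin N => P) {x | Real.log (∫ θ, Real.exp (-lam * h θ) ∂P) +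
      Real.log (1 + (Real.exp (lam * C) - 1) / N) * Real.sqrt ((N : ℝ) / 2 * Real.log (1 / δ))
      < Real.log ((1 / (N : ℝ)) * ∑ n, Real.exp (-lam * h (x n)))} ≤ ENNReal.ofReal δ := by
  have hN0 : (0:ℝ) < N := by exact_mod_cast hN
  set e := Real.exp (-lam * C) with he
  have he0 : 0 < e := Real.exp_pos _
  have hE : Real.exp (lam * C) = 1 / e := by
    rw [he, neg_mul, Real.exp_neg, one_div, inv_inv]
  have he1 : e < 1 := by rw [he, Real.exp_lt_one_iff]; nlinarith
  set φ : Θ → ℝ := fun θ => Real.exp (-lam * h θ) with hφ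
  have hφm : Measurable φ := by fun_prop
  have hφ1 : ∀ θ, φ θ ≤ 1 := fun θ => by
    rw [hφ]; simp only; rw [Real.exp_le_one_iff]; nlinarith [(hb θ).1]
  have hφe : ∀ θ, e ≤ φ θ := fun θ => by
    rw [hφ, he]; simp only; rw [Real.exp_le_exp]; nlinarith [(hb θ).2]
  have hφa : ∀ θ, |φ θ| ≤ 1 := fun θ => abs_le.2 ⟨by linarith [hφe θ], hφ1 θ⟩
  have hφi : Integrable φ P := aux_int _ _ hφm 1 hφa
  set Z := ∫ θ, φ θ ∂P with hZ
  have hZe : e ≤ Z := by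
    have : ∫ θ, e ∂P ≤ ∫ θ, φ θ ∂P := integral_mono (integrable_const _) hφi hφe
    simpa using this
  have hZ0 : 0 < Z := he0.trans_le hZe
  set u : (Fin N → Θ) → ℝ := fun x => (1 / (N : ℝ)) * ∑ n, φ (x n) with hu
  have hum : Measurable u := by fun_prop
  have hsum : ∀ x : Fin N → Θ, N * e ≤ ∑ n, φ (x n) := fun x => by
    have := Finset.sum_le_sum (s := Finset.univ) fun n (_ : n ∈ Finset.univ) => hφe (x n)
    simpa using this
  have hsum1 : ∀ x : Fin N → Θ, ∑ n, φ (x n) ≤ N := fun x => by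
    have := Finset.sum_le_sum (s := Finset.univ) fun n (_ : n ∈ Finset.univ) => hφ1 (x n)
    simpa using this
  have hue : ∀ x, e ≤ u x := fun x => by
    have := hsum x
    simp only [hu]; rw [one_div_mul_eq_div, le_div_iff₀ hN0]; linarith
  have hu1 : ∀ x, u x ≤ 1 := fun x => by
    have := hsum1 x
    simp only [hu]; rw [one_div_mul_eq_div, div_le_iff₀ hN0]; linarith
  have hu0 : ∀ x, 0 < u x := fun x => he0.trans_le (hue x)
  have hfB : ∀ x, |Real.log (u x)| ≤ lam * C := fun x => by
    rw [abs_le]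
    constructor
    · have := Real.log_le_log he0 (hue x)
      rw [he, Real.log_exp] at this; linarith
    · have := Real.log_nonpos (hu0 x).le (hu1 x)
      have : 0 < lam * C := by positivity
      linarith
  have hfm : Measurable fun x => Real.log (u x) := by fun_prop
  have hE1 : 0 < (Real.exp (lam * C) - 1) / N := by
    rw [hE]; apply div_pos _ hN0
    rw [sub_pos, lt_div_iff₀ he0]; linarith
  have hdiff : ∀ x i y, Real.log (u (Function.update x i y)) - Real.log (u x) ≤
      Real.log (1 + (Real.exp (lam * C) - 1) / N) := fun x i y => by
    rw [sub_le_iff_le_add, ← Real.log_mul (by positivity) (hu0 x).ne']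
    apply Real.log_le_log (hu0 _)
    have h1 := sum_upd φ x i y
    have h2 : u (Function.update x i y) = u x + (1 / (N : ℝ)) * (φ y - φ (x i)) := by
      rw [← h1]; simp only [hu]; ring
    have h3 : (1 / (N : ℝ)) * (φ y - φ (x i)) ≤ (1 / (N:ℝ)) * (1 - e) :=
      mul_le_mul_of_nonneg_left (by linarith [hφ1 y, hφe (x i)]) (by positivity)
    have h4 : (Real.exp (lam * C) - 1) / N * e ≤ (Real.exp (lam * C) - 1) / N * u x :=
      mul_le_mul_of_nonneg_left (hue x) hE1.le
    have h5 : (Real.exp (lam * C) - 1) / N * e = (1 / (N:ℝ)) * (1 - e) := by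
      rw [hE]; field_simp
    rw [h2, add_mul]; linarith
  have main := chern P _ (lam * C) (Real.log_pos (by linarith)) N hN _ hfm hfB hdiff δ hδ
  have hui : Integrable u (Measure.pi fun _ : Fin N => P) :=
    aux_int _ _ hum 1 fun x => abs_le.2 ⟨by linarith [hu0 x], hu1 x⟩
  have huZ : ∫ x, u x ∂(Measure.pi fun _ : Fin N => P) = Z := by
    simp only [hu]
    rw [integral_const_mul, integral_finsetSum]
    · simp_rw [integral_comp_eval (μ := fun _ : Fin N => P) (f := φ) hφm.aestronglyMeasurable]
      simp [← hZ]; field_simp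
    · intro i _
      exact aux_int _ _ (by fun_prop) 1 fun x => hφa _
  have jens : ∫ x, Real.log (u x) ∂(Measure.pi fun _ : Fin N => P) ≤ Real.log Z := by
    have : ∫ x, Real.log (u x) ∂(Measure.pi fun _ : Fin N => P) ≤
        ∫ x, (Real.log Z - 1 + u x / Z) ∂(Measure.pi fun _ : Fin N => P) := by
      refine integral_mono (aux_int _ _ hfm _ hfB)
        ((integrable_const _).add (hui.div_const _)) fun x => ?_
      have := Real.log_le_sub_one_of_pos (div_pos (hu0 x) hZ0)
      rw [Real.log_div (hu0 x).ne' hZ0.ne'] at this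
      simp only; linarith
    rw [integral_add (integrable_const _) (hui.div_const _), integral_div, huZ,
      div_self hZ0.ne'] at this
    simpa using this
  refine le_trans (measure_mono fun x hx => ?_) main
  simp only [Set.mem_ofPred_eq] at hx ⊢
  exact le_trans (by linarith) hx.le

lemma hoeffS {W : Type*} [MeasurableSpace W] (D : Measure W) [IsProbabilityMeasure D]
    (C : ℝ) (h : W → ℝ) (hh : Measurable h) (hb : ∀ w, h w ∈ Set.Icc 0 C)
    (S : ℕ) (hS : 1 ≤ S) (lam : ℝ) :
    ∫⁻ d, ENNReal.ofReal (Real.exp (lam * ((1 / (S : ℝ)) * ∑ s, h (d s)) - lam * ∫ w, h w ∂D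
      - lam ^ 2 * C ^ 2 / (8 * S))) ∂(Measure.pi fun _ : Fin S => D) ≤ 1 := by
  have hS0 : (0:ℝ) < S := by exact_mod_cast hS
  have hha : ∀ w, |h w| ≤ C := fun w => abs_le.2 ⟨by linarith [(hb w).1, (hb w).2], (hb w).2⟩
  set f : (Fin S → W) → ℝ := fun d => (1 / (S : ℝ)) * ∑ s, h (d s) with hf
  have hfm : Measurable f := by fun_prop
  have hfB : ∀ d, |f d| ≤ C := fun d => by
    have h1 := Finset.sum_le_sum (s := Finset.univ) fun n (_ : n ∈ Finset.univ) => (hb (d n)).1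
    have h2 := Finset.sum_le_sum (s := Finset.univ) fun n (_ : n ∈ Finset.univ) => (hb (d n)).2
    simp at h1 h2
    rw [abs_of_nonneg (by simp only [hf]; positivity)]
    simp only [hf]; rw [one_div_mul_eq_div, div_le_iff₀ hS0]; linarith
  have hdiff : ∀ x i y, f (Function.update x i y) - f x ≤ C / S := fun x i y => by
    simp only [hf]
    rw [← mul_sub, sum_upd, one_div_mul_eq_div]
    gcongr
    linarith [(hb y).2, (hb (x i)).1]
  have hfint : ∫ x, f x ∂(Measure.pi fun _ : Fin S => D) = ∫ w, h w ∂D := by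
    simp only [hf]
    rw [integral_const_mul, integral_finsetSum]
    · simp_rw [integral_comp_eval (μ := fun _ : Fin S => D) (f := h) hh.aestronglyMeasurable]
      simp; field_simp
    · intro i _
      exact aux_int _ _ (by fun_prop) C fun x => hha _
  have m := mcd D (C / S) lam C S f hfm hfB hdiff
  rw [hfint] at m
  have e : ∀ d, Real.exp (lam * f d - lam * ∫ w, h w ∂D - lam ^ 2 * C ^ 2 / (8 * S)) =
      Real.exp (- (lam * ∫ w, h w ∂D + lam ^ 2 * (S * (C / S) ^ 2) / 8)) *
        Real.exp (lam * f d) := fun d => by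
    rw [← Real.exp_add]; congr 1; field_simp; ring
  change ∫⁻ d, ENNReal.ofReal (Real.exp (lam * f d - lam * ∫ w, h w ∂D
      - lam ^ 2 * C ^ 2 / (8 * S))) ∂(Measure.pi fun _ : Fin S => D) ≤ 1
  simp_rw [e]
  rw [← ofReal_integral_eq_lintegral_ofReal ((aux_int_exp _ f hfm C hfB lam).const_mul _)
    (Filter.Eventually.of_forall fun d => by positivity), integral_const_mul,
    ENNReal.ofReal_le_one, Real.exp_neg, inv_mul_le_iff₀ (Real.exp_pos _), mul_one]
  exact m

/-- Tractable PAC-Bayes lower bound for the optimal Gibbs posterior, with the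
partition function replaced by its Monte Carlo estimate. -/
theorem pac_bayes_lower_bound_monte_carlo
    {Θ W : Type*} [MeasurableSpace Θ] [MeasurableSpace W]
    (D : Measure W) [IsProbabilityMeasure D]
    (C : ℝ) (hC : 0 < C)
    (L : Θ × W → ℝ) (hL : Measurable L) (hLb : ∀ θ w, L (θ, w) ∈ Set.Icc 0 C)
    (S NP : ℕ) (hS : 1 ≤ S) (hNP : 1 ≤ NP)
    (P : Measure Θ) [IsProbabilityMeasure P]
    (lam : ℝ) (hlam : 0 < lam)
    (Qstar : Kernel (Fin S → W) Θ) [IsMarkovKernel Qstar]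
    (hQ : ∀ data : Fin S → W,
      Qstar data = P.withDensity fun θ => ENNReal.ofReal
        (Real.exp (-lam * ((1 / (S : ℝ)) * ∑ s : Fin S, L (θ, data s))) /
          ∫ θ', Real.exp (-lam * ((1 / (S : ℝ)) * ∑ s : Fin S, L (θ', data s))) ∂P))
    (δ : ℝ) (hδ : δ ∈ Set.Ioo (0 : ℝ) 1) :
    ENNReal.ofReal (1 - 2 * δ) ≤
      ((((Measure.pi fun _ : Fin S => D) ⊗ₘ Qstar)).prod
          (Measure.pi fun _ : Fin NP => P))
        {p : ((Fin S → W) × Θ) × (Fin NP → Θ) |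
          2 * ((1 / (S : ℝ)) * ∑ s : Fin S, L (p.1.2, p.1.1 s))
            + (1 / lam) * Real.log
              ((1 / (NP : ℝ)) * ∑ n : Fin NP,
                Real.exp (-lam * ((1 / (S : ℝ)) * ∑ s : Fin S, L (p.2 n, p.1.1 s))))
            - (1 / lam) * Real.log (1 / δ)
            - lam * C ^ 2 / (8 * S)
            - (1 / lam) * Real.log (1 + (Real.exp (lam * C) - 1) / NP) *
                Real.sqrt (((NP : ℝ) / 2) * Real.log (1 / δ))
            ≤ (∫ w, L (p.1.2, w) ∂D)} := by
  have hS0 : (0:ℝ) < S := by exact_mod_cast hS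
  set Lh : (Fin S → W) → Θ → ℝ := fun d θ => (1 / (S : ℝ)) * ∑ s : Fin S, L (θ, d s) with hLh
  set Z : (Fin S → W) → ℝ := fun d => ∫ θ, Real.exp (-lam * Lh d θ) ∂P with hZ
  set T : Θ → ℝ := fun θ => ∫ w, L (θ, w) ∂D with hT
  have hLm : Measurable fun p : (Fin S → W) × Θ => Lh p.1 p.2 := by
    simp only [hLh]; fun_prop
  have hLθ : ∀ d, Measurable (Lh d) := fun d => hLm.comp measurable_prodMk_left
  have hZm : Measurable Z := by
    have : Measurable fun p : (Fin S → W) × Θ => Real.exp (-lam * Lh p.1 p.2) := by fun_prop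
    exact this.stronglyMeasurable.integral_prod_right.measurable
  have hTm : Measurable T := hL.stronglyMeasurable.integral_prod_right'.measurable
  have hLhb : ∀ d θ, Lh d θ ∈ Set.Icc 0 C := fun d θ => by
    have h1 := Finset.sum_le_sum (s := Finset.univ)
      fun n (_ : n ∈ Finset.univ) => (hLb θ (d n)).1
    have h2 := Finset.sum_le_sum (s := Finset.univ)
      fun n (_ : n ∈ Finset.univ) => (hLb θ (d n)).2
    simp at h1 h2
    refine ⟨by simp only [hLh]; positivity, ?_⟩
    simp only [hLh]; rw [one_div_mul_eq_div, div_le_iff₀ hS0]; linarith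
  have hZ0 : ∀ d, 0 < Z d := fun d => by
    have hi : Integrable (fun θ => Real.exp (-lam * Lh d θ)) P :=
      aux_int_exp P (Lh d) (hLθ d) C
        (fun θ => by rw [abs_of_nonneg (hLhb d θ).1]; exact (hLhb d θ).2) _
    exact integral_exp_pos hi
  set μ := (Measure.pi fun _ : Fin S => D) ⊗ₘ Qstar with hμ
  set ν := Measure.pi fun _ : Fin NP => P with hν
  set c := Real.log (1 + (Real.exp (lam * C) - 1) / NP) *
    Real.sqrt (((NP : ℝ) / 2) * Real.log (1 / δ)) with hc
  let F : (Fin S → W) × Θ → ℝ := fun q =>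
    Real.exp (lam * Lh q.1 q.2 - lam * T q.2 - lam ^ 2 * C ^ 2 / (8 * S)) *
      (Real.exp (lam * Lh q.1 q.2) * Z q.1)
  have hFm : Measurable F := by
    have : Measurable fun q : (Fin S → W) × Θ => Z q.1 := hZm.comp measurable_fst
    have : Measurable fun q : (Fin S → W) × Θ => T q.2 := hTm.comp measurable_snd
    simp only [F]; fun_prop
  have hFint : ∫⁻ q, ENNReal.ofReal (F q) ∂μ ≤ 1 := by
    rw [hμ, Measure.lintegral_compProd (by fun_prop)]
    have e : ∀ d, ∫⁻ θ, ENNReal.ofReal (F (d, θ)) ∂(Qstar d) = ∫⁻ θ, ENNReal.ofReal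
        (Real.exp (lam * Lh d θ - lam * T θ - lam ^ 2 * C ^ 2 / (8 * S))) ∂P := fun d => by
      rw [hQ d, lintegral_withDensity_eq_lintegral_mul]
      · refine lintegral_congr fun θ => ?_
        rw [Pi.mul_apply, ← ENNReal.ofReal_mul (div_nonneg (Real.exp_pos _).le (hZ0 d).le)]
        congr 1
        simp only [F]
        have h1 : Real.exp (-lam * Lh d θ) * Real.exp (lam * Lh d θ) = 1 := by
          rw [← Real.exp_add]; simp
        have h2 := (hZ0 d).ne'
        change Real.exp (-lam * Lh d θ) / Z d * _ = _
        generalize Real.exp (-lam * Lh d θ) = a at *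
        generalize Real.exp (lam * Lh d θ) = b at *
        generalize Real.exp (lam * Lh d θ - lam * T θ - lam ^ 2 * C ^ 2 / (8 * S)) = k at *
        field_simp
        linear_combination k * h1
      · have := hLθ d
        change Measurable fun θ => ENNReal.ofReal (Real.exp (-lam * Lh d θ) / Z d)
        fun_prop
      · fun_prop
    simp_rw [e]
    rw [lintegral_lintegral_swap]
    · calc _ ≤ ∫⁻ θ, 1 ∂P := by
            refine lintegral_mono fun θ => ?_
            exact hoeffS D C (fun w => L (θ, w)) (by fun_prop) (hLb θ) S hS lam
        _ = 1 := by simp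
    · have : Measurable fun q : (Fin S → W) × Θ => T q.2 := hTm.comp measurable_snd
      simp only [Function.uncurry_def]
      fun_prop
  have hB1 : μ {q | ENNReal.ofReal (1 / δ) ≤ ENNReal.ofReal (F q)} ≤ ENNReal.ofReal δ := by
    have hd : 0 < 1 / δ := one_div_pos.2 hδ.1
    have := meas_ge_le_lintegral_div (μ := μ) (f := fun q => ENNReal.ofReal (F q))
      (by fun_prop) (ε := ENNReal.ofReal (1 / δ)) (by simpa using hδ.1) (by simp)
    refine this.trans ((ENNReal.div_le_div_right hFint _).trans ?_)
    rw [one_div δ, ENNReal.ofReal_inv_of_pos hδ.1]; simp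
  set B1 : Set (((Fin S → W) × Θ) × (Fin NP → Θ)) :=
    Prod.fst ⁻¹' {q | ENNReal.ofReal (1 / δ) ≤ ENNReal.ofReal (F q)} with hB1d
  have hB1' : (μ.prod ν) B1 ≤ ENNReal.ofReal δ := by
    rw [hB1d, ← Set.prod_univ, Measure.prod_prod, measure_univ, mul_one]
    exact hB1
  let Zh : ((Fin S → W) × Θ) × (Fin NP → Θ) → ℝ := fun p =>
    (1 / (NP : ℝ)) * ∑ n : Fin NP, Real.exp (-lam * Lh p.1.1 (p.2 n))
  have hZhm : Measurable Zh := by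
    have : ∀ n : Fin NP, Measurable fun p : ((Fin S → W) × Θ) × (Fin NP → Θ) =>
        Lh p.1.1 (p.2 n) := fun n =>
      hLm.comp (f := fun p : ((Fin S → W) × Θ) × (Fin NP → Θ) => (p.1.1, p.2 n)) (by fun_prop)
    simp only [Zh]; fun_prop
  set B2 : Set (((Fin S → W) × Θ) × (Fin NP → Θ)) :=
    {p | Real.log (Z p.1.1) + c < Real.log (Zh p)} with hB2d
  have hB2 : (μ.prod ν) B2 ≤ ENNReal.ofReal δ := by
    have hm : MeasurableSet B2 := measurableSet_lt (by fun_prop) (by fun_prop)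
    rw [Measure.prod_apply hm]
    calc _ ≤ ∫⁻ q, ENNReal.ofReal δ ∂μ := by
          refine lintegral_mono fun q => ?_
          exact mcZ P C hC (Lh q.1) (hLθ _) (hLhb _) NP hNP lam hlam δ hδ
      _ = _ := by simp
  set E : Set (((Fin S → W) × Θ) × (Fin NP → Θ)) := _
  change _ ≤ (μ.prod ν) E
  have hcover : (Set.univ : Set (((Fin S → W) × Θ) × (Fin NP → Θ))) ⊆ E ∪ (B1 ∪ B2) := by
    intro p _
    by_contra hp
    simp only [Set.mem_union, not_or] at hp
    obtain ⟨hpE, hp1, hp2⟩ := hp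
    apply hpE
    simp only [hB2d, Set.mem_ofPred_eq, not_lt] at hp2
    have hp1 : F p.1 < 1 / δ := by
      have h : ¬ (ENNReal.ofReal (1 / δ) ≤ ENNReal.ofReal (F p.1)) := hp1
      by_contra h'
      exact h (ENNReal.ofReal_le_ofReal (not_lt.1 h'))
    have hFpos : 0 < F p.1 := by
      have := hZ0 p.1.1
      simp only [F]; positivity
    have h1 := (Real.log_lt_log hFpos hp1).le
    have h2 : Real.log (F p.1) = lam * Lh p.1.1 p.1.2 - lam * T p.1.2 -
        lam ^ 2 * C ^ 2 / (8 * S) + (lam * Lh p.1.1 p.1.2 + Real.log (Z p.1.1)) := by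
      simp only [F]
      rw [Real.log_mul (Real.exp_pos _).ne' (mul_pos (Real.exp_pos _) (hZ0 _)).ne',
        Real.log_mul (Real.exp_pos _).ne' (hZ0 _).ne', Real.log_exp, Real.log_exp]
    change 2 * Lh p.1.1 p.1.2 + (1 / lam) * Real.log (Zh p) - (1 / lam) * Real.log (1 / δ)
      - lam * C ^ 2 / (8 * S) - (1 / lam) * Real.log (1 + (Real.exp (lam * C) - 1) / NP) *
        Real.sqrt (((NP : ℝ) / 2) * Real.log (1 / δ)) ≤ T p.1.2
    rw [mul_assoc (1 / lam) (Real.log (1 + _)), ← hc]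
    have h3 : 2 * (lam * Lh p.1.1 p.1.2) + Real.log (Zh p) - Real.log (1 / δ)
        - lam ^ 2 * C ^ 2 / (8 * S) - c ≤ lam * T p.1.2 := by linarith
    refine le_of_mul_le_mul_left (le_trans (le_of_eq ?_) h3) hlam
    field_simp
  have hone : (1 : ENNReal) ≤ (μ.prod ν) E + ENNReal.ofReal (2 * δ) := by
    calc (1 : ENNReal) = (μ.prod ν) Set.univ := by simp
      _ ≤ (μ.prod ν) E + ((μ.prod ν) B1 + (μ.prod ν) B2) :=
        (measure_mono hcover).trans ((measure_union_le _ _).trans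
          (add_le_add le_rfl (measure_union_le _ _)))
      _ ≤ (μ.prod ν) E + (ENNReal.ofReal δ + ENNReal.ofReal δ) := by gcongr
      _ = _ := by rw [← ENNReal.ofReal_add hδ.1.le hδ.1.le, two_mul]
  rw [ENNReal.ofReal_sub _ (by linarith [hδ.1]), ENNReal.ofReal_one]
  exact tsub_le_iff_right.2 hone
end
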